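/- arXiv:1407.3516 — 3 statements merged into one kernel-verified Lean document; each statement's English description precedes it below -/
import Mathlib

section
/- In the ring of formal power series in two variables x, v over ℚ, let 𝒞 = Σ_{n≥0} C_n x^n and let A = Σ_{n≥1} Σ_{m=1}^{n} a(n,m) x^n v^m. Then A·(1 − x·v·𝒞) = x·v. -/
/-- A Catalan word: a word `a : Fin n → ℕ` satisfying (i) `a (i+1) ≥ a i - 1` for all
adjacent positions, and (ii) if `i` is the minimal index with `a i = k > 0`, then there
exist `i₁ < i < i₂` with `a i₁ = a i₂ = k - 1`. -/
def IsCatalanWord {n : ℕ} (a : Fin n → ℕ) : Prop :=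
  (∀ (i : ℕ) (h : i + 1 < n), a ⟨i, Nat.lt_of_succ_lt h⟩ ≤ a ⟨i + 1, h⟩ + 1) ∧
  (∀ i : Fin n, 0 < a i → (∀ j : Fin n, a j = a i → i ≤ j) →
    ((∃ i₁ : Fin n, i₁ < i ∧ a i₁ + 1 = a i) ∧ (∃ i₂ : Fin n, i < i₂ ∧ a i₂ + 1 = a i)))

/-- The number of letters of the word `a` equal to `c`. -/
noncomputable def countEq {n : ℕ} (a : Fin n → ℕ) (c : ℕ) : ℕ :=
  Set.ncard {i : Fin n | a i = c}

/-- `aZ n m` is the number of Catalan words of length `n` with exactly `m` zeros. -/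
noncomputable def aZ (n m : ℕ) : ℕ :=
  Set.ncard {a : Fin n → ℕ | IsCatalanWord a ∧ countEq a 0 = m}

/-- The two-variable power series `A = Σ_{n≥1} Σ_{m=1}^{n} a(n,m) xⁿ vᵐ` over `ℚ`,
with variable `0` playing the role of `x` and variable `1` the role of `v`. -/
noncomputable def Amv : MvPowerSeries (Fin 2) ℚ :=
  fun e => if 1 ≤ e 1 ∧ e 1 ≤ e 0 then (aZ (e 0) (e 1) : ℚ) else 0

/-- The two-variable power series `𝒞 = Σ_{n≥0} Cₙ xⁿ` over `ℚ` (constant in `v`). -/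
noncomputable def Cmv : MvPowerSeries (Fin 2) ℚ :=
  fun e => if e 1 = 0 then (catalan (e 0) : ℚ) else 0

/-- Consecutive letters of a word drop by at most one. -/
def DropsByAtMostOne (l : List ℕ) : Prop :=
  l.IsChain fun x y => x ≤ y + 1

/-- Every first occurrence of a positive letter `k + 1` has a letter `k` on both sides. -/
def FirstsFlanked (l : List ℕ) : Prop :=
  ∀ l₁ k l₂, l = l₁ ++ (k + 1) :: l₂ → k + 1 ∉ l₁ → k ∈ l₁ ∧ k ∈ l₂

/-- The nonzero letters of a word, each lowered by one. -/
def lower (l : List ℕ) : List ℕ :=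
  l.filterMap Nat.ppred

@[simp] lemma lower_nil : lower [] = [] := rfl

@[simp] lemma lower_zero_cons (l : List ℕ) : lower (0 :: l) = lower l := rfl

@[simp] lemma lower_succ_cons (k : ℕ) (l : List ℕ) : lower ((k + 1) :: l) = k :: lower l := rfl

@[simp] lemma lower_append (l₁ l₂ : List ℕ) : lower (l₁ ++ l₂) = lower l₁ ++ lower l₂ :=
  List.filterMap_append

@[simp] lemma mem_lower {k : ℕ} {l : List ℕ} : k ∈ lower l ↔ k + 1 ∈ l := by
  simp [lower, List.mem_filterMap, Nat.ppred_eq_some]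

@[simp] lemma lower_map_succ (l : List ℕ) : lower (l.map (· + 1)) = l := by
  induction l with
  | nil => rfl
  | cons x l ih => simp [ih]

@[simp] lemma lower_replicate_zero (n : ℕ) : lower (List.replicate n 0) = [] := by
  induction n with
  | zero => rfl
  | succ n ih => simp [List.replicate_succ, ih]

lemma length_eq_count_add_length_lower (l : List ℕ) :
    l.length = l.count 0 + (lower l).length := by
  induction l with
  | nil => rfl
  | cons x l ih => cases x <;> simp <;> omega

lemma map_succ_lower {l : List ℕ} (h : 0 ∉ l) : (lower l).map (· + 1) = l := by
  induction l with
  | nil => rfl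
  | cons x l ih => cases x <;> simp_all

lemma eq_replicate_of_lower_eq_nil {l : List ℕ} (h : lower l = []) :
    l = List.replicate (l.count 0) 0 := by
  induction l with
  | nil => rfl
  | cons x l ih =>
    cases x with
    | zero => rw [List.count_cons_self, List.replicate_succ, ← ih (by simpa using h)]
    | succ k => simp at h

lemma dropsByAtMostOne_cons_cons {x y : ℕ} {l : List ℕ} :
    DropsByAtMostOne (x :: y :: l) ↔ x ≤ y + 1 ∧ DropsByAtMostOne (y :: l) :=
  List.isChain_cons_cons

lemma DropsByAtMostOne.pred_cons_lower {l : List ℕ} :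
    ∀ {p : ℕ}, DropsByAtMostOne (p :: l) → DropsByAtMostOne ((p - 1) :: lower l) := by
  induction l with
  | nil => intro p _; exact List.isChain_singleton _
  | cons x l ih =>
    intro p h
    rw [dropsByAtMostOne_cons_cons] at h
    have := ih h.2
    cases x with
    | zero =>
      have hp : p - 1 = 0 := by omega
      simpa [hp] using this
    | succ k =>
      rw [lower_succ_cons, dropsByAtMostOne_cons_cons]
      exact ⟨by omega, this⟩

lemma FirstsFlanked.head_eq_zero {x : ℕ} {l : List ℕ} (h : FirstsFlanked (x :: l)) : x = 0 := by
  cases x with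
  | zero => rfl
  | succ k => simpa using h [] k l rfl

lemma FirstsFlanked.lower {l : List ℕ} (h : FirstsFlanked l) : FirstsFlanked (lower l) := by
  intro r₁ k r₂ hr hk
  obtain ⟨l₁, l', rfl, rfl, hl'⟩ := List.filterMap_eq_append_iff.1 hr
  obtain ⟨z, x, l₂, rfl, hz, hx, rfl⟩ := List.filterMap_eq_cons_iff.1 hl'
  obtain rfl := Nat.ppred_eq_some.1 hx
  have hz' : ∀ y ∈ z, y = 0 := fun y hy => Nat.ppred_eq_none.1 (hz y hy)
  have hk' : k + 1 + 1 ∉ l₁ ++ z := by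
    intro hm
    rcases List.mem_append.1 hm with hm | hm
    · exact hk (mem_lower.2 hm)
    · simpa using hz' _ hm
  obtain ⟨h₁, h₂⟩ := h (l₁ ++ z) (k + 1) l₂ (by simp) hk'
  refine ⟨?_, mem_lower.2 h₂⟩
  rcases List.mem_append.1 h₁ with hm | hm
  · exact mem_lower.2 hm
  · simpa using hz' _ hm

/-- The words with `m` zeros whose nonzero letters, lowered by one, spell `b`, and which may
follow a letter `p`. -/
def zeroInsertions (p : ℕ) (b : List ℕ) (m : ℕ) : Set (List ℕ) :=
  {a | DropsByAtMostOne (p :: a) ∧ lower a = b ∧ a.count 0 = m}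

lemma zeroInsertions_nil_zero (p : ℕ) : zeroInsertions p [] 0 = {[]} := by
  ext a
  rcases a with _ | ⟨_ | x, a⟩ <;>
    simp [zeroInsertions, DropsByAtMostOne]

lemma zeroInsertions_nil_succ (p m : ℕ) :
    zeroInsertions p [] (m + 1) =
      if p ≤ 1 then List.cons 0 '' zeroInsertions 0 [] m else ∅ := by
  ext a
  rcases a with _ | ⟨_ | x, a⟩ <;> split_ifs <;>
    simp [zeroInsertions, DropsByAtMostOne, List.isChain_cons_cons, *]

lemma zeroInsertions_cons_zero {p c : ℕ} (h : p - 1 ≤ c + 1) (b : List ℕ) :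
    zeroInsertions p (c :: b) 0 = List.cons (c + 1) '' zeroInsertions (c + 1) b 0 := by
  have h' : p ≤ c + 1 + 1 := by omega
  ext a
  rcases a with _ | ⟨_ | x, a⟩
  · simp [zeroInsertions]
  · simp [zeroInsertions]
  · simp only [zeroInsertions, dropsByAtMostOne_cons_cons, lower_succ_cons, Set.mem_ofPred_eq,
      Set.mem_image, List.cons.injEq]
    grind

lemma zeroInsertions_cons_succ {p c : ℕ} (h : p - 1 ≤ c + 1) (b : List ℕ) (m : ℕ) :
    zeroInsertions p (c :: b) (m + 1) =
      List.cons (c + 1) '' zeroInsertions (c + 1) b (m + 1) ∪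
        if p ≤ 1 then List.cons 0 '' zeroInsertions 0 (c :: b) m else ∅ := by
  have h' : p ≤ c + 1 + 1 := by omega
  ext a
  rcases a with _ | ⟨_ | x, a⟩
  · split_ifs <;> simp [zeroInsertions]
  · split_ifs <;> simp [zeroInsertions, dropsByAtMostOne_cons_cons, *]
  · simp only [zeroInsertions, dropsByAtMostOne_cons_cons, lower_succ_cons, Set.mem_ofPred_eq,
      Set.mem_image, List.cons.injEq, Set.mem_union]
    split_ifs <;> simp <;> grind

lemma encard_zeroInsertions (b : List ℕ) : ∀ m p : ℕ, DropsByAtMostOne ((p - 1) :: b) →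
    (zeroInsertions p b m).encard = (((p - 1) :: b).count 0).multichoose m := by
  induction b with
  | nil =>
    intro m
    induction m with
    | zero => intro p _; simp [zeroInsertions_nil_zero]
    | succ m ih =>
      intro p _
      rw [zeroInsertions_nil_succ]
      split_ifs with hp
      · have hp' : p - 1 = 0 := by omega
        rw [List.cons_injective.encard_image, ih 0 (List.isChain_singleton _), hp']
        simp
      · have hp' : p - 1 ≠ 0 := by omega
        simp [hp']
  | cons c b ihb =>
    intro m
    induction m with
    | zero =>
      intro p h
      rw [dropsByAtMostOne_cons_cons] at h
      rw [zeroInsertions_cons_zero h.1, List.cons_injective.encard_image, ihb 0 (c + 1) (by simpa using h.2)]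
      simp
    | succ m ih =>
      intro p h
      rw [dropsByAtMostOne_cons_cons] at h
      rw [zeroInsertions_cons_succ h.1]
      split_ifs with hp
      · have hp' : p - 1 = 0 := by omega
        rw [Set.encard_union_eq, List.cons_injective.encard_image, List.cons_injective.encard_image,
          ihb _ _ (by simpa using h.2), ih 0 (dropsByAtMostOne_cons_cons.2 ⟨by omega, h.2⟩), hp']
        · rw [List.count_cons_self, Nat.multichoose_succ_succ]
          simp
        · rw [Set.disjoint_left]
          rintro _ ⟨_, _, rfl⟩ ⟨_, _, h⟩
          simp at h
      · have hp' : p - 1 ≠ 0 := by omega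
        rw [Set.union_empty, List.cons_injective.encard_image, ihb _ _ (by simpa using h.2),
          List.count_cons_of_ne hp']
        simp

/-- Catalan words, as lists. -/
def IsCatalanList (l : List ℕ) : Prop :=
  DropsByAtMostOne l ∧ FirstsFlanked l

lemma IsCatalanList.lower {l : List ℕ} (h : IsCatalanList l) : IsCatalanList (lower l) := by
  refine ⟨?_, h.2.lower⟩
  have : DropsByAtMostOne (0 :: l) := by
    cases l with
    | nil => exact List.isChain_singleton _
    | cons x l => exact dropsByAtMostOne_cons_cons.2 ⟨by omega, h.1⟩
  exact this.pred_cons_lower.tail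

/-- The Catalan words with `m` zeros lowering to `b`. -/
def catalanFiber (b : List ℕ) (m : ℕ) : Set (List ℕ) :=
  {a | IsCatalanList a ∧ lower a = b ∧ a.count 0 = m}

lemma dropsByAtMostOne_replicate_append {b : List ℕ} (hb : DropsByAtMostOne b) (n : ℕ) :
    DropsByAtMostOne (0 :: (List.replicate n 0 ++ b.map (· + 1))) := by
  induction n with
  | zero =>
    cases b with
    | nil => exact List.isChain_singleton _
    | cons x b =>
      refine dropsByAtMostOne_cons_cons.2 ⟨by omega, ?_⟩
      rw [← List.map_cons (f := (· + 1)), DropsByAtMostOne, List.isChain_map]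
      exact List.IsChain.imp (fun x y h => by omega) hb
  | succ n ih =>
    rw [List.replicate_succ, List.cons_append, dropsByAtMostOne_cons_cons]
    exact ⟨by omega, ih⟩

lemma firstsFlanked_zero_cons {b a : List ℕ} {m : ℕ} (hb : IsCatalanList (0 :: b))
    (hl : lower a = 0 :: b) (hc : a.count 0 = m)
    (hne : a ≠ List.replicate m 0 ++ (0 :: b).map (· + 1)) : FirstsFlanked (0 :: a) := by
  intro l₁ k l₂ h hk
  have hlow : 0 :: b = lower l₁ ++ k :: lower l₂ := by
    rw [← hl, ← lower_zero_cons, h]; simp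
  cases k with
  | succ k =>
    obtain ⟨h₁, h₂⟩ := hb.2 _ _ _ hlow (by simpa using hk)
    exact ⟨mem_lower.1 h₁, mem_lower.1 h₂⟩
  | zero =>
    cases l₁ with
    | nil => simp at h
    | cons x l₁ =>
      rw [List.cons_append, List.cons.injEq] at h
      obtain ⟨rfl, h⟩ := h
      refine ⟨by simp, ?_⟩
      by_contra h₂
      apply hne
      have hnil : lower l₁ = [] := by
        rcases hx : lower l₁ with _ | ⟨y, r⟩
        · rfl
        · rw [lower_zero_cons, hx, List.cons_append, List.cons.injEq] at hlow
          have : 0 ∈ lower l₁ := by simp [hx, ← hlow.1]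
          exact absurd (List.mem_cons_of_mem 0 (mem_lower.1 this)) hk
      have h₁ := eq_replicate_of_lower_eq_nil hnil
      have hm : l₁.count 0 = m := by
        rw [← hc, h]; simp [List.count_eq_zero.2 h₂]
      rw [hm] at h₁
      rw [h, lower_append, hnil, lower_succ_cons] at hl
      simp only [List.nil_append, List.cons.injEq, true_and] at hl
      rw [h, ← hl, List.map_cons, map_succ_lower h₂, ← h₁]

lemma zeroInsertions_eq {b : List ℕ} (hb : IsCatalanList (0 :: b)) (m : ℕ) :
    List.cons 0 '' zeroInsertions 0 (0 :: b) m =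
      catalanFiber (0 :: b) (m + 1) ∪ {0 :: (List.replicate m 0 ++ (0 :: b).map (· + 1))} := by
  ext a
  constructor
  · rintro ⟨a, ⟨h₁, h₂, h₃⟩, rfl⟩
    by_cases hne : a = List.replicate m 0 ++ (0 :: b).map (· + 1)
    · right; simp [hne]
    · left
      exact ⟨⟨h₁, firstsFlanked_zero_cons hb h₂ h₃ hne⟩, by simpa using h₂, by simpa using h₃⟩
  · rintro (⟨h₁, h₂, h₃⟩ | rfl)
    · cases a with
      | nil => simp at h₃
      | cons x a =>
        obtain rfl := h₁.2.head_eq_zero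
        exact ⟨a, ⟨h₁.1, by simpa using h₂, by simpa using h₃⟩, rfl⟩
    · refine ⟨_, ⟨dropsByAtMostOne_replicate_append hb.1 m, ?_, ?_⟩, rfl⟩
      · rw [lower_append, lower_map_succ]; simp
      · have : ((0 :: b).map (· + 1)).count 0 = 0 := List.count_eq_zero.2 (by simp)
        rw [List.count_append, this]
        simp

lemma encard_catalanFiber {b : List ℕ} (hb : IsCatalanList b) (hne : b ≠ []) (m : ℕ) :
    (catalanFiber b (m + 1)).encard + 1 = (b.count 0 + 1).multichoose m := by
  rcases b with _ | ⟨x, b⟩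
  · exact absurd rfl hne
  obtain rfl := hb.2.head_eq_zero
  have h := encard_zeroInsertions (0 :: b) m 0 (dropsByAtMostOne_cons_cons.2 ⟨by omega, hb.1⟩)
  rw [← (List.cons_injective (a := 0)).encard_image, zeroInsertions_eq hb, Set.encard_union_eq,
    Set.encard_singleton] at h
  · simpa using h
  · rw [Set.disjoint_singleton_right]
    rintro ⟨h₁, -, -⟩
    have := (h₁.2 (0 :: List.replicate m 0) 0 (b.map (· + 1)) (by simp) (by simp)).2
    simp at this

lemma FirstsFlanked.range_subset {l : List ℕ} (h : FirstsFlanked l) :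
    ∀ {x : ℕ}, x ∈ l → Finset.range (x + 1) ⊆ l.toFinset := by
  intro x
  induction x with
  | zero => intro hx y hy; simp_all
  | succ x ih =>
    intro hx
    obtain ⟨l₁, l₂, hl, hx'⟩ := List.eq_append_cons_of_mem hx
    rw [Finset.range_add_one, Finset.insert_subset_iff]
    refine ⟨by simpa using hx, ih ?_⟩
    rw [hl]
    exact List.mem_append_left _ (h _ _ _ hl hx').1

lemma FirstsFlanked.lt_length {l : List ℕ} (h : FirstsFlanked l) {x : ℕ} (hx : x ∈ l) :
    x < l.length := by
  have := (Finset.card_le_card (h.range_subset hx)).trans l.toFinset_card_le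
  simpa using this

lemma finite_catalanList (n : ℕ) : {l | IsCatalanList l ∧ l.length = n}.Finite := by
  refine ((List.finite_length_eq (Fin n) n).image (List.map Fin.val)).subset ?_
  rintro l ⟨hl, hn⟩
  refine ⟨l.pmap Fin.mk fun x hx => hn ▸ hl.2.lt_length hx, by simpa using hn, ?_⟩
  simp [List.map_pmap]

/-- The number of Catalan words of length `n` with `m` zeros. -/
noncomputable def catalanCount (n m : ℕ) : ℕ :=
  {l | IsCatalanList l ∧ l.length = n ∧ l.count 0 = m}.ncard

lemma catalanCount_self (m : ℕ) : catalanCount m m = 1 := by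
  rw [catalanCount, Set.ncard_eq_one]
  refine ⟨List.replicate m 0, ?_⟩
  ext l
  constructor
  · rintro ⟨-, h₂, h₃⟩
    have := length_eq_count_add_length_lower l
    have h := eq_replicate_of_lower_eq_nil (l := l) (List.length_eq_zero_iff.1 (by omega))
    rwa [h₃] at h
  · rintro rfl
    refine ⟨⟨?_, ?_⟩, by simp, by simp⟩
    · have := dropsByAtMostOne_replicate_append (b := []) List.isChain_nil m
      rw [List.map_nil, List.append_nil] at this
      exact this.tail
    · intro l₁ k l₂ h
      have : k + 1 ∈ List.replicate m 0 := by simp [h]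
      simp at this

open Finset in
lemma catalanCount_add {k : ℕ} (hk : 0 < k) (m : ℕ) :
    catalanCount (k + (m + 1)) (m + 1) + ∑ j ∈ range k, catalanCount k (j + 1) =
      ∑ j ∈ range k, catalanCount k (j + 1) * (j + 2).multichoose m := by
  classical
  set V := (finite_catalanList k).toFinset with hV
  have hVmem : ∀ b, b ∈ V ↔ IsCatalanList b ∧ b.length = k := by simp [hV]
  have hcount : ∀ f : ℕ → ℕ, ∑ b ∈ V, f (b.count 0) =
      ∑ j ∈ range k, catalanCount k (j + 1) * f (j + 1) := by
    intro f
    rw [← sum_fiberwise_of_maps_to (s := V) (t := range k) (g := fun b => b.count 0 - 1)]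
    · refine sum_congr rfl fun j hj => ?_
      have hfil : (({b ∈ V | b.count 0 - 1 = j} : Finset _) : Set (List ℕ)) =
          {l | IsCatalanList l ∧ l.length = k ∧ l.count 0 = j + 1} := by
        ext b
        simp only [coe_filter, hVmem, Set.mem_ofPred_eq]
        refine ⟨fun ⟨⟨h₁, h₂⟩, h₃⟩ => ⟨h₁, h₂, ?_⟩, fun ⟨h₁, h₂, h₃⟩ => ⟨⟨h₁, h₂⟩, by omega⟩⟩
        have : 0 < b.count 0 := by
          rcases b with _ | ⟨x, b⟩
          · simp at h₂; omega
          · obtain rfl := h₁.2.head_eq_zero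
            simp
        omega
      rw [catalanCount, ← hfil, Set.ncard_coe_finset, ← smul_eq_mul, ← sum_const]
      refine sum_congr rfl fun b hb => ?_
      have : b ∈ {l | IsCatalanList l ∧ l.length = k ∧ l.count 0 = j + 1} := hfil ▸ hb
      rw [this.2.2]
    · intro b hb
      rw [hVmem] at hb
      have := List.count_le_length (a := 0) (l := b)
      simp only [mem_range]
      omega
  have hfin : {l | IsCatalanList l ∧ l.length = k + (m + 1) ∧ l.count 0 = m + 1}.Finite :=
    (finite_catalanList (k + (m + 1))).subset fun l h => ⟨h.1, h.2.1⟩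
  have h₁ := hcount fun _ => 1
  have h₂ := hcount fun j => (j + 1).multichoose m
  simp only [mul_one] at h₁
  rw [← h₁, ← h₂, catalanCount, Set.ncard_eq_toFinset_card _ hfin,
    card_eq_sum_card_fiberwise (f := lower) (t := V), ← sum_add_distrib]
  · refine sum_congr rfl fun b hb => ?_
    rw [hVmem] at hb
    have hne : b ≠ [] := by rintro rfl; simp at hb; omega
    have h := encard_catalanFiber hb.1 hne m
    have hfib : catalanFiber b (m + 1) = ({a ∈ hfin.toFinset | lower a = b} : Finset _) := by
      ext a
      have := length_eq_count_add_length_lower a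
      simp only [catalanFiber, coe_filter, Set.Finite.mem_toFinset, Set.mem_ofPred_eq]
      constructor
      · rintro ⟨h₁, rfl, h₂⟩
        exact ⟨⟨h₁, by omega, h₂⟩, rfl⟩
      · rintro ⟨⟨h₁, -, h₂⟩, rfl⟩
        exact ⟨h₁, rfl, h₂⟩
    rw [hfib, Set.encard_coe_eq_coe_finsetCard] at h
    exact_mod_cast h
  · intro a ha
    have := length_eq_count_add_length_lower a
    simp only [Set.Finite.coe_toFinset, Set.mem_ofPred_eq] at ha
    rw [mem_coe, hVmem]
    exact ⟨ha.1.lower, by omega⟩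

open PowerSeries in
/-- The coefficients of the powers of the Catalan series. -/
noncomputable def catalanPowCoeff (k p : ℕ) : ℕ :=
  coeff k (catalanSeries ^ p)

lemma catalanPowCoeff_zero_left (p : ℕ) : catalanPowCoeff 0 p = 1 := by
  simp [catalanPowCoeff]

lemma catalanPowCoeff_succ_zero (k : ℕ) : catalanPowCoeff (k + 1) 0 = 0 := by
  simp [catalanPowCoeff, PowerSeries.coeff_one]

lemma catalanPowCoeff_succ_succ (k p : ℕ) :
    catalanPowCoeff (k + 1) (p + 1) = catalanPowCoeff (k + 1) p + catalanPowCoeff k (p + 2) := by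
  have h : PowerSeries.catalanSeries ^ (p + 1) =
      PowerSeries.catalanSeries ^ p + PowerSeries.catalanSeries ^ (p + 2) * PowerSeries.X := by
    calc PowerSeries.catalanSeries ^ (p + 1)
      _ = PowerSeries.catalanSeries ^ p *
          (PowerSeries.catalanSeries ^ 2 * PowerSeries.X + 1) := by
        rw [PowerSeries.catalanSeries_sq_mul_X_add_one, pow_succ]
      _ = _ := by ring
  rw [catalanPowCoeff, h, map_add, PowerSeries.coeff_succ_mul_X]
  rfl

open Finset in
lemma sum_catalan_mul_catalanPowCoeff (k p : ℕ) :
    ∑ i ∈ range (k + 1), catalan i * catalanPowCoeff (k - i) p = catalanPowCoeff k (p + 1) := by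
  rw [catalanPowCoeff, pow_succ', PowerSeries.coeff_mul,
    Nat.sum_antidiagonal_eq_sum_range_succ_mk]
  simp [catalanPowCoeff]

open Finset in
lemma sum_catalanPowCoeff_mul_multichoose (p : ℕ) : ∀ k q : ℕ,
    ∑ j ∈ range (k + 1), catalanPowCoeff (k - j) (q + j) * (j + 1).multichoose p =
      catalanPowCoeff k (q + p + 1) := by
  induction p with
  | zero =>
    intro k
    induction k with
    | zero => intro q; simp [catalanPowCoeff_zero_left]
    | succ k ih =>
      intro q
      have h := ih (q + 1)
      rw [sum_range_succ', add_zero, catalanPowCoeff_succ_succ, ← h, add_comm]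
      simp [add_assoc, add_comm 1]
  | succ p ihp =>
    intro k
    induction k with
    | zero => intro q; simp [catalanPowCoeff_zero_left]
    | succ k ih =>
      intro q
      have h := ih (q + 1)
      simp only [Nat.multichoose_succ_succ, mul_add, sum_add_distrib]
      rw [ihp, sum_range_succ']
      simp only [Nat.multichoose_zero_succ, mul_zero, add_zero, Nat.add_sub_add_right]
      rw [show q + (p + 1) + 1 = q + p + 1 + 1 by ring, catalanPowCoeff_succ_succ _ (q + p + 1),
        show q + p + 1 + 2 = q + 1 + (p + 1) + 1 by ring, ← h, add_comm]
      simp [add_assoc, add_comm 1]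

open Finset in
lemma sum_catalanPowCoeff_mul_multichoose_succ (k p : ℕ) :
    ∑ j ∈ range (k + 1), catalanPowCoeff (k - j) j * (j + 2).multichoose p =
      catalanPowCoeff (k + 1) p + ∑ j ∈ range (k + 1), catalanPowCoeff (k - j) j := by
  induction p with
  | zero => simp [catalanPowCoeff_succ_zero]
  | succ p ih =>
    have h := sum_catalanPowCoeff_mul_multichoose (p + 1) k 0
    simp only [Nat.multichoose_succ_succ (_ + 1), mul_add, sum_add_distrib, ih]
    simp only [zero_add] at h
    rw [h, catalanPowCoeff_succ_succ]
    ring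

lemma catalanCount_eq (k : ℕ) : ∀ m : ℕ,
    catalanCount (k + (m + 1)) (m + 1) = catalanPowCoeff k m := by
  induction k using Nat.strong_induction_on with
  | _ k ih =>
    intro m
    cases k with
    | zero => rw [zero_add, catalanCount_self, catalanPowCoeff_zero_left]
    | succ k =>
      have h := catalanCount_add k.succ_pos m
      have hc : ∀ j ∈ Finset.range (k + 1),
          catalanCount (k + 1) (j + 1) = catalanPowCoeff (k - j) j := by
        intro j hj
        rw [Finset.mem_range] at hj
        rw [← ih (k - j) (by omega) j]
        congr 1
        omega
      have hs : ∀ j ∈ Finset.range (k + 1), catalanCount (k + 1) (j + 1) * (j + 2).multichoose m =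
          catalanPowCoeff (k - j) j * (j + 2).multichoose m := fun j hj => by rw [hc j hj]
      rw [Nat.succ_eq_add_one, Finset.sum_congr rfl hc, Finset.sum_congr rfl hs,
        sum_catalanPowCoeff_mul_multichoose_succ] at h
      exact Nat.add_right_cancel h

lemma isCatalanList_ofFn {n : ℕ} (a : Fin n → ℕ) :
    IsCatalanList (List.ofFn a) ↔ IsCatalanWord a := by
  refine and_congr ?_ ⟨fun h i hi hmin => ?_, fun h l₁ k l₂ hl hk => ?_⟩
  · rw [DropsByAtMostOne, List.isChain_iff_getElem]
    simp
  · obtain ⟨k, hk⟩ := Nat.exists_eq_add_one.2 hi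
    have hi' : (i : ℕ) < (List.ofFn a).length := by simp
    have hsplit : List.ofFn a =
        (List.ofFn a).take i ++ (k + 1) :: (List.ofFn a).drop (i + 1) := by
      conv_lhs => rw [← List.take_append_drop i (List.ofFn a), List.drop_eq_getElem_cons hi']
      simp [hk]
    have hnot : k + 1 ∉ (List.ofFn a).take i := by
      intro hm
      obtain ⟨j, hj, hjk⟩ := List.mem_take_iff_getElem.1 hm
      have hj' : j < i ∧ j < n := by simp at hj; omega
      have := hmin ⟨j, hj'.2⟩ (by simpa [hk] using hjk)
      rw [Fin.le_def] at this
      exact absurd hj'.1 (not_lt.2 this)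
    obtain ⟨h₁, h₂⟩ := h _ _ _ hsplit hnot
    constructor
    · obtain ⟨j, hj, hjk⟩ := List.mem_take_iff_getElem.1 h₁
      have hj' : j < i ∧ j < n := by simp at hj; omega
      exact ⟨⟨j, hj'.2⟩, hj'.1, by rw [hk, ← hjk]; simp⟩
    · obtain ⟨j, hj, hjk⟩ := List.mem_drop_iff_getElem.1 h₂
      have hj' : i + 1 + j < n := by simpa [add_comm] using hj
      exact ⟨⟨i + 1 + j, hj'⟩, by rw [Fin.lt_def]; simp only; omega, by rw [hk, ← hjk]; simp⟩
  · have hlen : l₁.length + (l₂.length + 1) = n := by simpa using (congrArg List.length hl).symm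
    have hget : ∀ j : Fin n, a j = (l₁ ++ (k + 1) :: l₂)[j]'(by simp; omega) := by
      intro j
      simp [← hl]
    set i : Fin n := ⟨l₁.length, by omega⟩ with hi_def
    have hi : a i = k + 1 := by rw [hget]; simp [hi_def]
    have hmin : ∀ j : Fin n, a j = a i → i ≤ j := by
      intro j hj
      by_contra! hlt
      have hlt' : (j : ℕ) < l₁.length := hlt
      rw [hi, hget] at hj
      apply hk
      rw [← hj]
      simp [List.getElem_append_left hlt']
    obtain ⟨⟨j₁, hj₁, hk₁⟩, j₂, hj₂, hk₂⟩ := h i (by omega) hmin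
    have e₁ : a j₁ = k := by omega
    have e₂ : a j₂ = k := by omega
    constructor
    · have hlt : (j₁ : ℕ) < l₁.length := hj₁
      rw [← e₁, hget]
      simp [List.getElem_append_left hlt]
    · have hlt : l₁.length < (j₂ : ℕ) := hj₂
      obtain ⟨d, hd⟩ := Nat.exists_eq_add_of_lt hlt
      have hj : (j₂ : ℕ) = l₁.length + (d + 1) := by omega
      rw [← e₂, hget]
      simp [hj, List.getElem_append_right]

lemma count_ofFn {n : ℕ} (a : Fin n → ℕ) (c : ℕ) : (List.ofFn a).count c = countEq a c := by
  rw [countEq, Set.ncard_eq_toFinset_card', List.ofFn_eq_map, List.count, List.countP_map,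
    List.countP_eq_length_filter, ← List.toFinset_card_of_nodup ((List.nodup_finRange n).filter _)]
  congr 1
  ext
  simp

lemma aZ_eq_catalanCount (n m : ℕ) : aZ n m = catalanCount n m := by
  rw [aZ, catalanCount, ← Set.ncard_image_of_injective _ List.ofFn_injective]
  congr 1
  ext l
  constructor
  · rintro ⟨a, ⟨h₁, h₂⟩, rfl⟩
    exact ⟨(isCatalanList_ofFn a).2 h₁, by simp, (count_ofFn a 0).trans h₂⟩
  · rintro ⟨h₁, rfl, h₃⟩
    refine ⟨l.get, ⟨?_, ?_⟩, List.ofFn_get l⟩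
    · rwa [← isCatalanList_ofFn, List.ofFn_get]
    · rwa [← count_ofFn, List.ofFn_get]

lemma coeff_Amv (e : Fin 2 →₀ ℕ) : MvPowerSeries.coeff e Amv =
    if 1 ≤ e 1 ∧ e 1 ≤ e 0 then (catalanPowCoeff (e 0 - e 1) (e 1 - 1) : ℚ) else 0 := by
  change (if _ then _ else _) = _
  split_ifs with h
  · rw [aZ_eq_catalanCount, ← catalanCount_eq, show e 1 - 1 + 1 = e 1 by omega,
      show e 0 - e 1 + e 1 = e 0 by omega]
  · rfl

lemma coeff_Cmv (e : Fin 2 →₀ ℕ) : MvPowerSeries.coeff e Cmv =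
    if e 1 = 0 then (catalan (e 0) : ℚ) else 0 := rfl

open Finset in
lemma coeff_Cmv_mul (f : MvPowerSeries (Fin 2) ℚ) (e : Fin 2 →₀ ℕ) :
    MvPowerSeries.coeff e (Cmv * f) =
      ∑ i ∈ range (e 0 + 1), catalan i * MvPowerSeries.coeff (e - Finsupp.single 0 i) f := by
  classical
  rw [MvPowerSeries.coeff_mul]
  symm
  apply sum_of_injOn fun i => (Finsupp.single 0 i, e - Finsupp.single 0 i)
  · intro i _ j _ h
    exact Finsupp.single_injective _ (Prod.ext_iff.1 h).1
  · intro i hi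
    have hi' : i ≤ e 0 := by simpa [Nat.lt_succ_iff] using hi
    simpa using add_tsub_cancel_of_le (Finsupp.single_le_iff.2 hi')
  · rintro ⟨d, d'⟩ hd hnot
    rw [coeff_Cmv, if_neg, zero_mul]
    intro h0
    apply hnot
    obtain rfl := mem_antidiagonal.1 hd
    have hd : d = Finsupp.single 0 (d 0) := by
      ext i; fin_cases i <;> simp_all
    refine ⟨d 0, by simp, ?_⟩
    simp only [← hd, add_tsub_cancel_left]
  · intro i _
    simp [coeff_Cmv]

open Finset in
lemma coeff_Cmv_mul_Amv {e : Fin 2 →₀ ℕ} : MvPowerSeries.coeff e (Cmv * Amv) =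
    if 1 ≤ e 1 ∧ e 1 ≤ e 0 then (catalanPowCoeff (e 0 - e 1) (e 1) : ℚ) else 0 := by
  rw [coeff_Cmv_mul]
  simp only [coeff_Amv, Finsupp.tsub_apply, Finsupp.single_eq_same, ne_eq, one_ne_zero,
    not_false_eq_true, Finsupp.single_eq_of_ne, tsub_zero]
  split_ifs with h
  · have hs := sum_catalan_mul_catalanPowCoeff (e 0 - e 1) (e 1 - 1)
    rw [show e 1 - 1 + 1 = e 1 by omega] at hs
    rw [← hs]
    push_cast
    symm
    apply sum_subset_zero_on_sdiff
    · intro i; simp; omega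
    · intro i hi
      simp only [mem_sdiff, mem_range] at hi
      rw [if_neg (by omega), mul_zero]
    · intro i hi
      rw [mem_range] at hi
      rw [if_pos (by omega), show e 0 - e 1 - i = e 0 - i - e 1 by omega]
  · refine sum_eq_zero fun i _ => ?_
    rw [if_neg (by omega), mul_zero]

lemma Amv_eq : Amv = MvPowerSeries.X 0 * MvPowerSeries.X 1 * (1 + Cmv * Amv) := by
  classical
  have hX : (MvPowerSeries.X 0 * MvPowerSeries.X 1 : MvPowerSeries (Fin 2) ℚ) =
      MvPowerSeries.monomial (Finsupp.single 0 1 + Finsupp.single 1 1) 1 := by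
    rw [MvPowerSeries.X, MvPowerSeries.X, MvPowerSeries.monomial_mul_monomial, one_mul]
  ext e
  rw [hX, MvPowerSeries.coeff_monomial_mul, coeff_Amv, one_mul, map_add, coeff_Cmv_mul_Amv,
    MvPowerSeries.coeff_one]
  have hle : Finsupp.single 0 1 + Finsupp.single 1 1 ≤ e ↔ 1 ≤ e 0 ∧ 1 ≤ e 1 := by
    simp [Finsupp.le_def, Fin.forall_fin_two]
  have hzero : e - (Finsupp.single 0 1 + Finsupp.single 1 1) = 0 ↔ e 0 ≤ 1 ∧ e 1 ≤ 1 := by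
    simp [Finsupp.ext_iff, Fin.forall_fin_two, Nat.sub_eq_zero_iff_le]
  simp only [hle, hzero, Finsupp.tsub_apply, Finsupp.add_apply]
  simp only [Finsupp.single_apply, Fin.isValue, zero_ne_one, one_ne_zero, if_true, if_false,
    add_zero, zero_add]
  generalize e 0 = s
  generalize e 1 = t
  rcases s with _ | s
  · rw [if_neg (by omega), if_neg (by omega)]
  rcases t with _ | t
  · rw [if_neg (by omega), if_neg (by omega)]
  simp only [Nat.add_sub_cancel, Nat.add_sub_add_right]
  rcases t with _ | t
  · rcases s with _ | s
    · simp [catalanPowCoeff_zero_left]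
    · simp [catalanPowCoeff_succ_zero]
  · by_cases h : t + 1 ≤ s <;> simp [h]

/-- In `ℚ⟦x,v⟧`: `A · (1 - x·v·𝒞) = x·v`. -/
theorem Amv_mul_eq :
    Amv * (1 - MvPowerSeries.X 0 * MvPowerSeries.X 1 * Cmv) =
      MvPowerSeries.X 0 * MvPowerSeries.X 1 := by
  linear_combination Amv_eq
end

section
/- For all real numbers x, v with 0 < x < 1/4 and 0 ≤ v ≤ 1, setting t = 1/(2√x), the series Σ_{j≥1} 1/( √x·(U_{j−1}(t) − v√x·U_{j−2}(t))·(U_j(t) − v√x·U_{j−1}(t)) ) converges and equals C(x)/(1 − x·v·C(x)). -/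
/-- `C(x) = (1 - √(1-4x))/(2x)`, the generating function of the Catalan numbers. -/
noncomputable def Cfun (x : ℝ) : ℝ := (1 - Real.sqrt (1 - 4*x)) / (2*x)

/-- Evaluation at `t` of the `n`-th Chebyshev polynomial of the second kind, with the
index extended to all integers by the recurrence `U n = 2x·U (n-1) - U (n-2)`
(so `U (-1) = 0`, `U (-2) = -1`). -/
noncomputable def chebU (n : ℤ) (t : ℝ) : ℝ := (Polynomial.Chebyshev.U ℝ n).eval t

open Filter Topology

/-- If `a` satisfies `a (n + 2) = a (n + 1) / s - a n` and is bounded below by `1`, the reciprocals of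
products of consecutive terms telescope against the decaying solution `r ^ n`. -/
theorem hasSum_one_div_mul_of_recurrence {a : ℕ → ℝ} {r s : ℝ} (hs : 0 < s)
    (hr0 : 0 ≤ r) (hr1 : r < 1) (hroot : s * (r ^ 2 + 1) = r)
    (hrec : ∀ n, a (n + 2) = a (n + 1) / s - a n) (ha : ∀ n, 1 ≤ a n)
    (hW : a 1 - r * a 0 ≠ 0) :
    HasSum (fun n => 1 / (s * a n * a (n + 1))) (1 / (s * a 0 * (a 1 - r * a 0))) := by
  have hpos : ∀ n, 0 < a n := fun n => one_pos.trans_le (ha n)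
  have hwronskian : ∀ n, r ^ n * a (n + 1) - r ^ (n + 1) * a n = a 1 - r * a 0 := by
    intro n
    induction n with
    | zero => simp
    | succ n ih =>
      rw [← ih, hrec n]
      field_simp
      linear_combination (-(r ^ n * a (n + 1))) * hroot
  have hterm : ∀ n, 1 / (s * a n * a (n + 1)) =
      1 / (s * (a 1 - r * a 0)) * (r ^ n / a n - r ^ (n + 1) / a (n + 1)) := by
    intro n
    have h₁ := (hpos n).ne'
    have h₂ := (hpos (n + 1)).ne'
    rw [div_sub_div _ _ h₁ h₂, mul_comm (a n) (r ^ (n + 1)), hwronskian n]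
    field_simp
  have hlim : Tendsto (fun n => r ^ n / a n) atTop (𝓝 0) :=
    squeeze_zero (fun n => div_nonneg (pow_nonneg hr0 n) (hpos n).le)
      (fun n => div_le_self (pow_nonneg hr0 n) (ha n))
      (tendsto_pow_atTop_nhds_zero_of_lt_one hr0 hr1)
  rw [hasSum_iff_tendsto_nat_of_nonneg fun n =>
    (one_div_pos.2 (mul_pos (mul_pos hs (hpos n)) (hpos (n + 1)))).le]
  simp_rw [hterm, ← Finset.mul_sum, Finset.sum_range_sub' fun n => r ^ n / a n]
  convert (hlim.const_sub (r ^ 0 / a 0)).const_mul (1 / (s * (a 1 - r * a 0))) using 2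
  have h₀ := (hpos 0).ne'
  field_simp
  ring

theorem one_le_of_recurrence {a : ℕ → ℝ} {s : ℝ} (hs : 0 < s) (hs2 : s ≤ 1 / 2)
    (hrec : ∀ n, a (n + 2) = a (n + 1) / s - a n) (h0 : 1 ≤ a 0) (h1 : a 0 ≤ a 1) (n : ℕ) :
    1 ≤ a n := by
  suffices h : 1 ≤ a n ∧ a n ≤ a (n + 1) from h.1
  induction n with
  | zero => exact ⟨h0, h1⟩
  | succ n ih =>
    refine ⟨ih.1.trans ih.2, ?_⟩
    have h : 2 * a (n + 1) ≤ a (n + 1) / s := by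
      rw [le_div_iff₀ hs]
      nlinarith [ih.1, ih.2]
    linarith [hrec n, ih.2]

theorem mul_Cfun_sq {x : ℝ} (hx0 : 0 < x) (hx : x ≤ 1 / 4) : x * Cfun x ^ 2 = Cfun x - 1 := by
  have h : Real.sqrt (1 - 4 * x) ^ 2 = 1 - 4 * x := Real.sq_sqrt (by linarith)
  unfold Cfun
  generalize Real.sqrt (1 - 4 * x) = d at h ⊢
  field_simp
  linear_combination h

theorem mul_Cfun_lt_half {x : ℝ} (hx0 : 0 < x) (hx : x < 1 / 4) : x * Cfun x < 1 / 2 := by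
  have h : 0 < Real.sqrt (1 - 4 * x) := Real.sqrt_pos.2 (by linarith)
  have h' : x * Cfun x = (1 - Real.sqrt (1 - 4 * x)) / 2 := by
    unfold Cfun
    field_simp
  linarith

theorem one_le_Cfun {x : ℝ} (hx0 : 0 < x) (hx : x ≤ 1 / 4) : 1 ≤ Cfun x := by
  nlinarith [mul_Cfun_sq hx0 hx, mul_nonneg hx0.le (sq_nonneg (Cfun x))]

theorem Cfun_lt_two {x : ℝ} (hx0 : 0 < x) (hx : x < 1 / 4) : Cfun x < 2 := by
  nlinarith [mul_Cfun_sq hx0 hx.le, mul_Cfun_lt_half hx0 hx, one_le_Cfun hx0 hx.le]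

theorem chebU_add_one (n : ℤ) (t : ℝ) : chebU (n + 1) t = 2 * t * chebU n t - chebU (n - 1) t := by
  simp [chebU, Polynomial.Chebyshev.U_add_one]


/-- `Σ_{j≥1} 1/(√x·(U_{j-1}(t) - v√x·U_{j-2}(t))·(U_j(t) - v√x·U_{j-1}(t))) = C(x)/(1 - xv·C(x))`
where `t = 1/(2√x)`.  The series over `j ≥ 1` is indexed by `j : ℕ` via `j ↦ j + 1`. -/
theorem chebyshev_sum_eq_C_div (x v : ℝ) (hx0 : 0 < x) (hx : x < 1/4)
    (hv0 : 0 ≤ v) (hv1 : v ≤ 1) :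
    Summable (fun j : ℕ => 1 / (Real.sqrt x *
      (chebU (j : ℤ) (1 / (2 * Real.sqrt x)) -
        v * Real.sqrt x * chebU ((j : ℤ) - 1) (1 / (2 * Real.sqrt x))) *
      (chebU ((j : ℤ) + 1) (1 / (2 * Real.sqrt x)) -
        v * Real.sqrt x * chebU (j : ℤ) (1 / (2 * Real.sqrt x))))) ∧
    ∑' j : ℕ, 1 / (Real.sqrt x *
      (chebU (j : ℤ) (1 / (2 * Real.sqrt x)) -
        v * Real.sqrt x * chebU ((j : ℤ) - 1) (1 / (2 * Real.sqrt x))) *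
      (chebU ((j : ℤ) + 1) (1 / (2 * Real.sqrt x)) -
        v * Real.sqrt x * chebU (j : ℤ) (1 / (2 * Real.sqrt x)))) =
      Cfun x / (1 - x * v * Cfun x) := by
  set s := Real.sqrt x
  have hs : 0 < s := Real.sqrt_pos.2 hx0
  have hsq : s ^ 2 = x := Real.sq_sqrt hx0.le
  have hs2 : s < 1 / 2 := by nlinarith
  have hc := mul_Cfun_sq hx0 hx.le
  have hc1 := one_le_Cfun hx0 hx.le
  have hc2 := Cfun_lt_two hx0 hx
  have hxc := mul_Cfun_lt_half hx0 hx
  set c := Cfun x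
  let a : ℕ → ℝ := fun j => chebU j (1 / (2 * s)) - v * s * chebU ((j : ℤ) - 1) (1 / (2 * s))
  have ht : 2 * (1 / (2 * s)) = 1 / s := by field_simp
  have ha0 : a 0 = 1 := by simp [a, chebU]
  have ha1 : a 1 = 1 / s - v * s := by
    simp only [a, chebU, Nat.cast_one, sub_self, Polynomial.Chebyshev.U_one,
      Polynomial.Chebyshev.U_zero, Polynomial.eval_mul, Polynomial.eval_X,
      Polynomial.eval_ofNat, Polynomial.eval_one, mul_one, ht]
  have hrec : ∀ n, a (n + 2) = a (n + 1) / s - a n := by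
    intro n
    have h₁ := chebU_add_one ((n : ℤ) + 1) (1 / (2 * s))
    have h₂ := chebU_add_one (n : ℤ) (1 / (2 * s))
    rw [ht, add_sub_cancel_right] at h₁
    rw [ht] at h₂
    simp only [a]
    push_cast
    rw [show (n : ℤ) + 2 = n + 1 + 1 by ring, add_sub_cancel_right, add_sub_cancel_right,
      h₁, h₂]
    ring
  have hvs : v * s ≤ 1 / 2 := by nlinarith
  have hinv : 2 ≤ 1 / s := by rw [le_div_iff₀ hs]; linarith
  have ha : ∀ n, 1 ≤ a n :=
    one_le_of_recurrence hs hs2.le hrec ha0.ge (by rw [ha0, ha1]; linarith)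
  have hr1 : s * c < 1 := by nlinarith
  have hvxc : x * v * c < 1 := by nlinarith [mul_nonneg hv0 (mul_pos hx0 (one_pos.trans_le hc1)).le]
  have hroot : s * ((s * c) ^ 2 + 1) = s * c := by
    linear_combination s * c ^ 2 * hsq + s * hc
  have hW : 0 < a 1 - s * c * a 0 := by rw [ha0, ha1]; linarith
  have hsum := hasSum_one_div_mul_of_recurrence hs (by positivity) hr1 hroot hrec ha hW.ne'
  have hval : 1 / (s * a 0 * (a 1 - s * c * a 0)) = c / (1 - x * v * c) := by
    rw [div_eq_div_iff (mul_pos (mul_pos hs (by linarith [ha 0])) hW).ne' (by linarith), ha0, ha1]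
    field_simp
    linear_combination (v * c + c ^ 2) * hsq + hc
  rw [hval] at hsum
  have hfun : ∀ j : ℕ, a (j + 1) =
      chebU ((j : ℤ) + 1) (1 / (2 * s)) - v * s * chebU (j : ℤ) (1 / (2 * s)) := by
    intro j
    simp [a]
  simp only [hfun] at hsum
  exact ⟨hsum.summable, hsum.tsum_eq⟩
end

section
/- For all real numbers x, v with 0 < x < 1/4 and 0 ≤ v ≤ 1, the double series B(x,v) = Σ_{n≥1} Σ_{m=0}^{n−1} b(n,m) x^n v^m converges and B(x,v) = x·(1 − x + x^2·v + x·v·(x−2)·C(x) + x^2·v^2·C(x)^2) / ( (1−x)·(1 − x·v·C(x))·(1 − x − x·v·C(x)) ). -/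
/-- `bO n m` is the number of Catalan words of length `n` with exactly `m` ones. -/
noncomputable def bO (n m : ℕ) : ℕ :=
  Set.ncard {a : Fin n → ℕ | IsCatalanWord a ∧ countEq a 1 = m}

/-- The `n`-th term (a finite sum over `m`) of the double series
`B(x,v) = Σ_{n≥1} Σ_{m=0}^{n-1} b(n,m) xⁿ vᵐ`.  (The term for `n = 0` is `0`.) -/
noncomputable def Bterm (x v : ℝ) (n : ℕ) : ℝ :=
  ∑ m ∈ Finset.range n, (bO n m : ℝ) * x ^ n * v ^ m

open Finset.HasAntidiagonal (antidiagonal)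

/-- The coefficient of `X ^ M` in the `z`-th power of the Catalan series. -/
noncomputable def ballot (M z : ℕ) : ℕ :=
  PowerSeries.coeff M (PowerSeries.catalanSeries ^ z)

theorem ballot_zero_right (M : ℕ) : ballot M 0 = if M = 0 then 1 else 0 := by
  simp [ballot, PowerSeries.coeff_one]

theorem ballot_zero_left (z : ℕ) : ballot 0 z = 1 := by
  simp [ballot]

theorem ballot_succ_succ (M z : ℕ) :
    ballot (M + 1) (z + 1) = ballot (M + 1) z + ballot M (z + 2) := by
  have h : PowerSeries.catalanSeries ^ (z + 1) =
      PowerSeries.catalanSeries ^ z + PowerSeries.catalanSeries ^ (z + 2) * PowerSeries.X := by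
    calc PowerSeries.catalanSeries ^ (z + 1)
        = PowerSeries.catalanSeries ^ z *
            (PowerSeries.catalanSeries ^ 2 * PowerSeries.X + 1) := by
          rw [PowerSeries.catalanSeries_sq_mul_X_add_one, pow_succ]
      _ = _ := by ring
  rw [ballot, h, map_add, PowerSeries.coeff_succ_mul_X]
  rfl

theorem sum_ballot_mul_multichoose (M z s : ℕ) :
    ∑ p ∈ antidiagonal M, ballot p.2 (p.1 + s) * Nat.multichoose z p.1 =
      ballot M (z + s) := by
  induction M generalizing z s with
  | zero => simp [ballot_zero_left, Nat.multichoose_zero_right]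
  | succ M ihM =>
    induction z with
    | zero => simp [Finset.Nat.sum_antidiagonal_succ, Nat.multichoose_zero_right]
    | succ z ihz =>
      rw [Finset.Nat.sum_antidiagonal_succ] at ihz ⊢
      simp only [Nat.multichoose_succ_succ, Nat.multichoose_zero_right, mul_add,
        Finset.sum_add_distrib] at ihz ⊢
      have h := ihM (z + 1) (s + 1)
      rw [← add_assoc, ihz, show z + 1 + s = z + s + 1 by ring, ballot_succ_succ]
      rw [show z + 1 + (s + 1) = z + s + 2 by ring] at h
      rw [← h]
      congr 1
      refine Finset.sum_congr rfl fun p _ => ?_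
      rw [show p.1 + 1 + s = p.1 + (s + 1) by ring]

theorem multichoose_succ_eq_multichoose_succ (a b : ℕ) :
    Nat.multichoose (a + 1) b = Nat.multichoose (b + 1) a := by
  rw [Nat.multichoose_eq, Nat.multichoose_eq, show a + 1 + b - 1 = a + b by omega,
    show b + 1 + a - 1 = a + b by omega, Nat.choose_symm_add]

theorem one_le_multichoose_succ (a b : ℕ) : 1 ≤ Nat.multichoose (a + 1) b := by
  rw [Nat.multichoose_eq]
  exact Nat.choose_pos (by omega)

theorem sum_ballot_mul_multichoose_sub_one (M z : ℕ) :
    ∑ p ∈ antidiagonal M, ballot p.2 p.1 * (Nat.multichoose (p.1 + 2) z - 1) =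
      ballot (M + 1) z := by
  induction z with
  | zero => simp [ballot_zero_right, Nat.multichoose_zero_right]
  | succ z ih =>
    rw [ballot_succ_succ, ← ih, ← sum_ballot_mul_multichoose M (z + 2) 0,
      ← Finset.sum_add_distrib]
    refine Finset.sum_congr rfl fun p _ => ?_
    have h1 := one_le_multichoose_succ (p.1 + 1) z
    rw [add_zero, ← mul_add, Nat.multichoose_succ_succ (p.1 + 1) z,
      multichoose_succ_eq_multichoose_succ p.1 (z + 1)]
    have h2 : p.1 + 2 = p.1 + 1 + 1 := rfl
    have h3 : z + 2 = z + 1 + 1 := rfl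
    rw [h2] at *
    rw [h3]
    congr 1
    omega

theorem sum_range_catalan_div_four_pow (N : ℕ) :
    ∑ n ∈ Finset.range N, (catalan n : ℝ) / 4 ^ n =
      2 - 2 * (Nat.centralBinom N : ℝ) / 4 ^ N := by
  induction N with
  | zero => simp
  | succ N ih =>
    have h1 : ((N : ℝ) + 1) * (Nat.centralBinom (N + 1) : ℝ) =
        2 * (2 * N + 1) * Nat.centralBinom N := by
      exact_mod_cast Nat.succ_mul_centralBinom_succ N
    have h2 : ((N : ℝ) + 1) * (catalan N : ℝ) = Nat.centralBinom N := by
      exact_mod_cast succ_mul_catalan_eq_centralBinom N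
    have h3 : (N : ℝ) + 1 ≠ 0 := by positivity
    have h4 : (Nat.centralBinom (N + 1) : ℝ) = 2 * (2 * N + 1) * catalan N := by
      apply mul_left_cancel₀ h3
      rw [h1, ← h2]
      ring
    rw [Finset.sum_range_succ, ih, h4, ← h2, pow_succ]
    field_simp
    ring

/-- Delete the zeros of a word and decrease its other letters by one. -/
def strip : List ℕ → List ℕ
  | [] => []
  | 0 :: w => strip w
  | (c + 1) :: w => c :: strip w

@[simp] theorem strip_nil : strip [] = [] := by rw [strip]

@[simp] theorem strip_zero_cons (w : List ℕ) : strip (0 :: w) = strip w := by rw [strip]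

@[simp] theorem strip_succ_cons (c : ℕ) (w : List ℕ) :
    strip ((c + 1) :: w) = c :: strip w := by rw [strip]

@[simp] theorem strip_append (p s : List ℕ) : strip (p ++ s) = strip p ++ strip s := by
  induction p with
  | nil => simp
  | cons c p ih => cases c <;> simp [ih]

@[simp] theorem mem_strip {k : ℕ} {w : List ℕ} : k ∈ strip w ↔ k + 1 ∈ w := by
  induction w with
  | nil => simp
  | cons c w ih => cases c <;> simp [ih]

theorem length_strip_add_count (w : List ℕ) : (strip w).length + w.count 0 = w.length := by
  induction w with
  | nil => simp
  | cons c w ih => cases c <;> simp <;> omega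

theorem count_strip (w : List ℕ) (k : ℕ) : (strip w).count k = w.count (k + 1) := by
  induction w with
  | nil => simp
  | cons c w ih => cases c <;> simp [ih, List.count_cons]

@[simp] theorem strip_replicate_zero (z : ℕ) : strip (List.replicate z 0) = [] := by
  induction z with
  | zero => simp
  | succ z ih => simp [List.replicate_succ, ih]

@[simp] theorem strip_map_succ (u : List ℕ) : strip (u.map (· + 1)) = u := by
  induction u with
  | nil => simp
  | cons c u ih => simp [ih]

theorem eq_replicate_of_strip_eq_nil {w : List ℕ} (h : strip w = []) :
    w = List.replicate (w.count 0) 0 := by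
  induction w with
  | nil => simp
  | cons c w ih =>
    cases c with
    | zero => simpa [List.replicate_succ] using ih (by simpa using h)
    | succ c => simp at h

theorem eq_map_succ_strip {w : List ℕ} (h : 0 ∉ w) : w = (strip w).map (· + 1) := by
  induction w with
  | nil => simp
  | cons c w ih =>
    cases c with
    | zero => simp at h
    | succ c => simpa using ih (by simpa using h)

theorem exists_of_strip_eq_append_cons {w p s : List ℕ} {k : ℕ} (h : strip w = p ++ k :: s) :
    ∃ p' s', w = p' ++ (k + 1) :: s' ∧ strip p' = p ∧ strip s' = s := by
  induction w generalizing p with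
  | nil => simp at h
  | cons c w ih =>
    cases c with
    | zero =>
      obtain ⟨p', s', rfl, rfl, rfl⟩ := ih (by simpa using h)
      exact ⟨0 :: p', s', by simp⟩
    | succ c =>
      cases p with
      | nil =>
        simp only [strip_succ_cons, List.nil_append, List.cons.injEq] at h
        exact ⟨[], w, by simp [h.1], by simp, h.2⟩
      | cons d p =>
        simp only [strip_succ_cons, List.cons_append, List.cons.injEq] at h
        obtain ⟨p', s', rfl, rfl, rfl⟩ := ih h.2
        exact ⟨(c + 1) :: p', s', by simp [h.1]⟩

/-- A word whose descents have size at most one. -/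
def SmallDescents (w : List ℕ) : Prop := w.IsChain fun a b => a ≤ b + 1

theorem smallDescents_nil : SmallDescents [] := List.isChain_nil

theorem smallDescents_cons {c : ℕ} {w : List ℕ} :
    SmallDescents (c :: w) ↔ (∀ b ∈ w.head?, c ≤ b + 1) ∧ SmallDescents w :=
  List.isChain_cons

theorem smallDescents_cons_of_le_one {c : ℕ} (hc : c ≤ 1) {w : List ℕ} :
    SmallDescents (c :: w) ↔ SmallDescents w := by
  rw [smallDescents_cons]
  exact and_iff_right fun _ _ => by omega

theorem SmallDescents.strip {w : List ℕ} (h : SmallDescents w) : SmallDescents (strip w) := by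
  induction w with
  | nil => simpa using h
  | cons c w ih =>
    have hw := (smallDescents_cons.1 h).2
    cases c with
    | zero => simpa using ih hw
    | succ c =>
      rw [strip_succ_cons, smallDescents_cons]
      refine ⟨fun b hb => ?_, ih hw⟩
      rcases w with _ | ⟨d, w⟩
      · simp at hb
      · have hd : c + 1 ≤ d + 1 := (smallDescents_cons.1 h).1 d (by simp)
        cases d with
        | zero => omega
        | succ d =>
          simp only [strip_succ_cons, List.head?_cons, Option.mem_def, Option.some.injEq] at hb
          omega

theorem smallDescents_map_succ {u : List ℕ} (h : SmallDescents u) :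
    SmallDescents (u.map (· + 1)) := by
  rw [SmallDescents, List.isChain_map]
  exact List.IsChain.imp (fun a b hab => by omega) h

theorem smallDescents_replicate_append {z : ℕ} {w : List ℕ} :
    SmallDescents (List.replicate z 0 ++ w) ↔ SmallDescents w := by
  induction z with
  | zero => simp
  | succ z ih =>
    rw [List.replicate_succ, List.cons_append, smallDescents_cons_of_le_one zero_le_one, ih]

/-- The words with small descents that have `z` zeros and become `u` after stripping. -/
def insertions (u : List ℕ) (z : ℕ) : Set (List ℕ) :=
  {w | strip w = u ∧ SmallDescents w ∧ w.count 0 = z}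

/-- The members of `insertions u z` that do not begin with a zero. -/
def innerInsertions (u : List ℕ) (z : ℕ) : Set (List ℕ) :=
  {w | w ∈ insertions u z ∧ w.head? ≠ some 0}

theorem zero_cons_mem_insertions {u w : List ℕ} {z : ℕ} :
    0 :: w ∈ insertions u (z + 1) ↔ w ∈ insertions u z := by
  simp [insertions, smallDescents_cons_of_le_one]

theorem insertions_zero (u : List ℕ) : insertions u 0 = innerInsertions u 0 := by
  ext w
  refine ⟨fun h => ⟨h, fun h0 => ?_⟩, fun h => h.1⟩
  obtain ⟨t, rfl⟩ := List.head?_eq_some_iff.1 h0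
  simpa using h.2.2

theorem insertions_succ (u : List ℕ) (z : ℕ) :
    insertions u (z + 1) = innerInsertions u (z + 1) ∪ (0 :: ·) '' insertions u z := by
  ext w
  constructor
  · intro h
    by_cases h0 : w.head? = some 0
    · obtain ⟨t, rfl⟩ := List.head?_eq_some_iff.1 h0
      exact Or.inr ⟨t, zero_cons_mem_insertions.1 h, rfl⟩
    · exact Or.inl ⟨h, h0⟩
  · rintro (h | ⟨t, ht, rfl⟩)
    · exact h.1
    · exact zero_cons_mem_insertions.2 ht

theorem innerInsertions_nil_zero : innerInsertions [] 0 = {[]} := by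
  ext w
  rcases w with _ | ⟨_ | c, w⟩ <;>
    simp [innerInsertions, insertions, smallDescents_nil]

theorem innerInsertions_nil_succ (z : ℕ) : innerInsertions [] (z + 1) = ∅ := by
  ext w
  rcases w with _ | ⟨_ | c, w⟩ <;>
    simp [innerInsertions, insertions]

theorem innerInsertions_zero_cons (u : List ℕ) (z : ℕ) :
    innerInsertions (0 :: u) z = (1 :: ·) '' insertions u z := by
  ext w
  rcases w with _ | ⟨_ | _ | c, w⟩
  · simp [innerInsertions, insertions]
  · simp [innerInsertions, insertions]
  · simp [innerInsertions, insertions, smallDescents_cons_of_le_one]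
  · simp [innerInsertions, insertions]

theorem innerInsertions_succ_cons {c : ℕ} {u : List ℕ} (hu : SmallDescents ((c + 1) :: u))
    (z : ℕ) : innerInsertions ((c + 1) :: u) z = ((c + 2) :: ·) '' innerInsertions u z := by
  ext w
  constructor
  · rintro ⟨⟨h1, h2, h3⟩, h4⟩
    rcases w with _ | ⟨_ | d, w⟩
    · simp at h1
    · simp at h4
    · simp only [strip_succ_cons, List.cons.injEq] at h1
      obtain ⟨rfl, h1⟩ := h1
      rw [smallDescents_cons] at h2
      refine ⟨w, ⟨⟨h1, h2.2, by simpa using h3⟩, fun h0 => ?_⟩, rfl⟩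
      have := h2.1 0 h0
      omega
  · rintro ⟨t, ⟨⟨rfl, h2, h3⟩, h4⟩, rfl⟩
    refine ⟨⟨by simp, smallDescents_cons.2 ⟨fun b hb => ?_, h2⟩, by simpa using h3⟩, by simp⟩
    rcases t with _ | ⟨_ | d, t⟩
    · simp at hb
    · simp at h4
    · simp only [List.head?_cons, Option.mem_def, Option.some.injEq] at hb
      have := (smallDescents_cons.1 hu).1 d (by simp)
      omega

theorem encard_insertions_of_encard_innerInsertions {u : List ℕ} {j : ℕ}
    (h : ∀ z, (innerInsertions u z).encard = Nat.multichoose j z) (z : ℕ) :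
    (insertions u z).encard = Nat.multichoose (j + 1) z := by
  induction z with
  | zero => rw [insertions_zero, h, Nat.multichoose_zero_right, Nat.multichoose_zero_right]
  | succ z ih =>
    rw [insertions_succ, Set.encard_union_eq, h, List.cons_injective.encard_image, ih,
      Nat.multichoose_succ_succ, Nat.cast_add]
    rw [Set.disjoint_left]
    rintro w ⟨-, h0⟩ ⟨t, -, rfl⟩
    exact h0 rfl

theorem encard_innerInsertions {u : List ℕ} (hu : SmallDescents u) (z : ℕ) :
    (innerInsertions u z).encard = Nat.multichoose (u.count 0) z := by
  induction u generalizing z with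
  | nil =>
    cases z with
    | zero => simp [innerInsertions_nil_zero]
    | succ z => simp [innerInsertions_nil_succ, Nat.multichoose_zero_succ]
  | cons c u ih =>
    have ih := ih (smallDescents_cons.1 hu).2
    cases c with
    | zero =>
      rw [innerInsertions_zero_cons, List.cons_injective.encard_image,
        encard_insertions_of_encard_innerInsertions ih, List.count_cons_self]
    | succ c =>
      rw [innerInsertions_succ_cons hu, List.cons_injective.encard_image, ih,
        List.count_cons_of_ne (Nat.succ_ne_zero c)]

theorem encard_insertions {u : List ℕ} (hu : SmallDescents u) (z : ℕ) :
    (insertions u z).encard = Nat.multichoose (u.count 0 + 1) z :=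
  encard_insertions_of_encard_innerInsertions (encard_innerInsertions hu) z

/-- The list form of `IsCatalanWord`. -/
structure IsCatalanList_s14 (w : List ℕ) : Prop where
  smallDescents : SmallDescents w
  mem_of_first : ∀ p k s, w = p ++ (k + 1) :: s → k + 1 ∉ p → k ∈ p ∧ k ∈ s

theorem IsCatalanList_s14.head_eq_zero {c : ℕ} {w : List ℕ} (h : IsCatalanList_s14 (c :: w)) :
    c = 0 := by
  rcases c with _ | c
  · rfl
  · simpa using (h.mem_of_first [] c w rfl (by simp)).1

theorem IsCatalanList_s14.strip {w : List ℕ} (h : IsCatalanList_s14 w) : IsCatalanList_s14 (strip w) := by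
  refine ⟨h.smallDescents.strip, fun p k s hw hp => ?_⟩
  obtain ⟨p', s', rfl, rfl, rfl⟩ := exists_of_strip_eq_append_cons hw
  simpa using h.mem_of_first p' (k + 1) s' rfl (by simpa using hp)

theorem isCatalanList_replicate (z : ℕ) : IsCatalanList_s14 (List.replicate z 0) := by
  refine ⟨by simpa using smallDescents_replicate_append.2 smallDescents_nil,
    fun p k s h => ?_⟩
  have : k + 1 ∈ List.replicate z 0 := by simp [h]
  simp [List.mem_replicate] at this

theorem isCatalanList_zero_cons_iff {w : List ℕ} (hw : strip w ≠ []) :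
    IsCatalanList_s14 (0 :: w) ↔ IsCatalanList_s14 (strip w) ∧ SmallDescents w ∧
      w ≠ List.replicate (w.count 0) 0 ++ (strip w).map (· + 1) := by
  constructor
  · intro h
    have hs : IsCatalanList_s14 (strip w) := by simpa using h.strip
    refine ⟨hs, (smallDescents_cons.1 h.smallDescents).2, fun heq => ?_⟩
    obtain ⟨c, u, hu⟩ := List.exists_cons_of_ne_nil hw
    rw [hu] at hs heq
    obtain rfl := hs.head_eq_zero
    have := (h.mem_of_first (0 :: List.replicate (w.count 0) 0) 0 (u.map (· + 1))
      (by conv_lhs => rw [heq]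
          simp) (by simp [List.mem_replicate])).2
    simp at this
  · rintro ⟨h1, h2, h3⟩
    refine ⟨(smallDescents_cons_of_le_one zero_le_one).2 h2, fun p k s h hp => ?_⟩
    rcases k with _ | k
    · rcases p with _ | ⟨c, p⟩
      · simp at h
      · simp only [List.cons_append, List.cons.injEq] at h
        obtain ⟨rfl, rfl⟩ := h
        refine ⟨by simp, ?_⟩
        by_contra hs
        rw [strip_append, strip_succ_cons] at h1
        have hp0 : strip p = [] := by
          by_contra hne
          obtain ⟨c, u, hu⟩ := List.exists_cons_of_ne_nil hne
          rw [hu, List.cons_append] at h1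
          obtain rfl := h1.head_eq_zero
          have : 0 ∈ strip p := by simp [hu]
          simp at this hp
          exact hp this
        apply h3
        rw [strip_append, hp0, strip_succ_cons, List.nil_append, List.map_cons,
          ← eq_map_succ_strip hs, List.count_append, List.count_cons_of_ne (by simp),
          List.count_eq_zero_of_not_mem hs, add_zero, ← eq_replicate_of_strip_eq_nil hp0]
    · have h4 : strip w = strip p ++ (k + 1) :: strip s := by
        rw [← strip_zero_cons, h, strip_append, strip_succ_cons]
      simpa using h1.mem_of_first _ _ _ h4 (by simpa using hp)

theorem Set.ncard_eq_sum_ncard_fiber {α β : Type*} {S : Set α} (hS : S.Finite) {f : α → β}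
    {t : Finset β} (hf : ∀ s ∈ S, f s ∈ t) :
    S.ncard = ∑ b ∈ t, {s | s ∈ S ∧ f s = b}.ncard := by
  classical
  rw [Set.ncard_eq_toFinset_card S hS,
    Finset.card_eq_sum_card_fiberwise (f := f) (t := t) (by simpa [Set.MapsTo] using hf)]
  refine Finset.sum_congr rfl fun b _ => ?_
  rw [← Set.ncard_coe_finset]
  congr 1
  ext s
  simp

theorem finite_insertions {u : List ℕ} (hu : SmallDescents u) (z : ℕ) :
    (insertions u z).Finite :=
  Set.finite_of_encard_eq_coe (encard_insertions hu z)

theorem IsCatalanList_s14.count_zero_pos {w : List ℕ} (h : IsCatalanList_s14 w) (hw : w ≠ []) :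
    0 < w.count 0 := by
  obtain ⟨c, u, rfl⟩ := List.exists_cons_of_ne_nil hw
  obtain rfl := h.head_eq_zero
  simp

theorem finite_isCatalanList (n : ℕ) : {w | IsCatalanList_s14 w ∧ w.length = n}.Finite := by
  induction n using Nat.strong_induction_on with
  | _ n ih =>
    rcases Nat.eq_zero_or_pos n with rfl | hn
    · refine (Set.finite_singleton []).subset fun w hw => ?_
      simpa using hw.2
    · refine ((Finset.range n).finite_toSet.biUnion fun k hk =>
        (ih k (by simpa using hk)).biUnion' fun u hu => Set.finite_iUnion fun z : Fin (n + 1) =>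
          finite_insertions hu.1.smallDescents z).subset ?_
      rintro w ⟨hw, hl⟩
      have h1 := length_strip_add_count w
      have h2 := hw.count_zero_pos (by rintro rfl; simp at hl; omega)
      simp only [Set.mem_iUnion]
      exact ⟨(strip w).length, by simp; omega, strip w, ⟨hw.strip, rfl⟩,
        ⟨w.count 0, by omega⟩, rfl, hw.smallDescents, rfl⟩

/-- Catalan words of length `n` with `z` zeros. -/
def zeroClass (n z : ℕ) : Set (List ℕ) :=
  {w | IsCatalanList_s14 w ∧ w.length = n ∧ w.count 0 = z}

/-- Catalan words with `z` zeros, `m` ones and `k` letters different from zero. -/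
def zeroOneClass (k z m : ℕ) : Set (List ℕ) :=
  {w | IsCatalanList_s14 w ∧ (strip w).length = k ∧ w.count 0 = z ∧ w.count 1 = m}

theorem finite_zeroClass (n z : ℕ) : (zeroClass n z).Finite :=
  (finite_isCatalanList n).subset fun _ hw => ⟨hw.1, hw.2.1⟩

theorem finite_zeroOneClass (k z m : ℕ) : (zeroOneClass k z m).Finite := by
  refine (finite_isCatalanList (k + z)).subset fun w hw => ⟨hw.1, ?_⟩
  rw [← length_strip_add_count, hw.2.1, hw.2.2.1]

theorem IsCatalanList_s14.eq_nil_of_count_zero {w : List ℕ} (h : IsCatalanList_s14 w)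
    (h0 : w.count 0 = 0) : w = [] := by
  by_contra hw
  exact (h.count_zero_pos hw).ne' h0

theorem zeroClass_zero_right {n : ℕ} (hn : n ≠ 0) : zeroClass n 0 = ∅ := by
  ext w
  simp only [zeroClass, Set.mem_ofPred_eq, Set.mem_empty_iff_false, iff_false]
  rintro ⟨h1, h2, h3⟩
  apply hn
  rw [← h2, h1.eq_nil_of_count_zero h3, List.length_nil]

theorem zeroClass_self (z : ℕ) : zeroClass z z = {List.replicate z 0} := by
  ext w
  simp only [zeroClass, Set.mem_ofPred_eq, Set.mem_singleton_iff]
  constructor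
  · rintro ⟨-, h2, h3⟩
    have := length_strip_add_count w
    have h4 : strip w = [] := List.eq_nil_of_length_eq_zero (by omega)
    rw [eq_replicate_of_strip_eq_nil h4, h3]
  · rintro rfl
    exact ⟨isCatalanList_replicate z, by simp, by simp⟩

theorem zeroOneClass_fiber {k m : ℕ} {u : List ℕ} (hk : k ≠ 0) (hu : u ∈ zeroClass k m)
    (z : ℕ) : {w | w ∈ zeroOneClass k (z + 1) m ∧ strip w = u} =
      (0 :: ·) '' (insertions u z \ {List.replicate z 0 ++ u.map (· + 1)}) := by
  obtain ⟨h1, h2, h3⟩ := hu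
  have hne : u ≠ [] := by
    rintro rfl
    exact hk h2.symm
  ext w
  constructor
  · rintro ⟨⟨hw, -, hz, -⟩, rfl⟩
    rcases w with _ | ⟨c, w⟩
    · simp at hz
    obtain rfl := hw.head_eq_zero
    rw [strip_zero_cons] at hne ⊢
    obtain ⟨-, h4, h5⟩ := (isCatalanList_zero_cons_iff hne).1 hw
    have hz : w.count 0 = z := by simpa using hz
    exact ⟨w, ⟨⟨rfl, h4, hz⟩, by rwa [Set.mem_singleton_iff, ← hz]⟩, rfl⟩
  · rintro ⟨w, ⟨⟨rfl, h4, rfl⟩, h5⟩, rfl⟩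
    refine ⟨⟨(isCatalanList_zero_cons_iff hne).2 ⟨h1, h4, h5⟩, by simpa using h2, by simp, ?_⟩,
      strip_zero_cons w⟩
    rw [← h3, count_strip]
    simp

theorem ncard_zeroOneClass {k : ℕ} (hk : k ≠ 0) (z m : ℕ) :
    (zeroOneClass k (z + 1) m).ncard =
      (zeroClass k m).ncard * (Nat.multichoose (m + 1) z - 1) := by
  rw [Set.ncard_eq_sum_ncard_fiber (finite_zeroOneClass k (z + 1) m) (f := strip)
    (t := (finite_zeroClass k m).toFinset), Finset.sum_const_nat
    (m := Nat.multichoose (m + 1) z - 1), ← Set.ncard_eq_toFinset_card _ (finite_zeroClass k m)]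
  · intro u hu
    rw [Set.Finite.mem_toFinset] at hu
    rw [zeroOneClass_fiber hk hu, Set.ncard_image_of_injective _ List.cons_injective,
      Set.ncard_sdiff_singleton_of_mem, Set.ncard_def, encard_insertions hu.1.smallDescents,
      hu.2.2, ENat.toNat_natCast]
    exact ⟨by simp, smallDescents_replicate_append.2
      (smallDescents_map_succ hu.1.smallDescents), by simp [List.count_eq_zero]⟩
  · intro w hw
    rw [Set.Finite.mem_toFinset]
    exact ⟨hw.1.strip, hw.2.1, by rw [count_strip, hw.2.2.2]⟩

theorem ncard_zeroClass_add (k z : ℕ) :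
    (zeroClass (k + z) z).ncard =
      ∑ m ∈ Finset.range (k + 1), (zeroOneClass k z m).ncard := by
  have hmem (w : List ℕ) : w ∈ zeroClass (k + z) z ↔
      IsCatalanList_s14 w ∧ (strip w).length = k ∧ w.count 0 = z := by
    have := length_strip_add_count w
    exact and_congr_right fun _ => by omega
  rw [Set.ncard_eq_sum_ncard_fiber (finite_zeroClass (k + z) z) (f := List.count 1)
    (t := Finset.range (k + 1))]
  · refine Finset.sum_congr rfl fun m _ => ?_
    congr 1
    ext w
    simp only [Set.mem_ofPred_eq, hmem, zeroOneClass, and_assoc]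
  · intro w hw
    have h1 := ((hmem w).1 hw).2.1
    have h2 := count_strip w 0
    have h3 := List.count_le_length (a := 0) (l := strip w)
    simp only [zero_add] at h2
    rw [Finset.mem_range]
    omega

theorem ncard_zeroClass (k z : ℕ) : (zeroClass (k + (z + 1)) (z + 1)).ncard = ballot k z := by
  induction k using Nat.strong_induction_on generalizing z with
  | _ k ih =>
    rcases k with _ | k
    · rw [zero_add, zeroClass_self, Set.ncard_singleton, ballot_zero_left]
    · simp only [ncard_zeroClass_add, ncard_zeroOneClass k.succ_ne_zero]
      rw [Finset.sum_range_succ', zeroClass_zero_right k.succ_ne_zero, Set.ncard_empty,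
        zero_mul, add_zero, ← sum_ballot_mul_multichoose_sub_one k z,
        Finset.Nat.sum_antidiagonal_eq_sum_range_succ_mk]
      refine Finset.sum_congr rfl fun i hi => ?_
      rw [Finset.mem_range] at hi
      rw [← ih (k - i) (by omega) i, show k - i + (i + 1) = k + 1 by omega]

theorem zeroClass_of_lt {n z : ℕ} (h : n < z) : zeroClass n z = ∅ := by
  ext w
  simp only [zeroClass, Set.mem_ofPred_eq, Set.mem_empty_iff_false, iff_false]
  rintro ⟨-, h2, h3⟩
  have := List.count_le_length (a := 0) (l := w)
  omega

/-- Catalan words of length `n` with `m` ones. -/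
def oneClass (n m : ℕ) : Set (List ℕ) :=
  {w | IsCatalanList_s14 w ∧ w.length = n ∧ w.count 1 = m}

theorem ncard_oneClass_zero {n : ℕ} : (oneClass n 0).ncard = 1 := by
  rw [Set.ncard_eq_one]
  refine ⟨List.replicate n 0, ?_⟩
  ext w
  simp only [oneClass, Set.mem_ofPred_eq, Set.mem_singleton_iff]
  constructor
  · rintro ⟨h1, rfl, h3⟩
    have h4 : strip w = [] := h1.strip.eq_nil_of_count_zero (by rw [count_strip, h3])
    have h5 := length_strip_add_count w
    rw [h4, List.length_nil, zero_add] at h5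
    rw [← h5]
    exact eq_replicate_of_strip_eq_nil h4
  · rintro rfl
    exact ⟨isCatalanList_replicate n, by simp, by simp [List.count_replicate]⟩

theorem oneClass_of_le {n m : ℕ} (hm : m ≠ 0) (h : n ≤ m) : oneClass n m = ∅ := by
  ext w
  simp only [oneClass, Set.mem_ofPred_eq, Set.mem_empty_iff_false, iff_false]
  rintro ⟨h1, h2, h3⟩
  have h4 := length_strip_add_count w
  have h5 := List.count_le_length (a := 0) (l := strip w)
  have h6 := h1.count_zero_pos (by rintro rfl; simp at h3; omega)
  have h7 := count_strip w 0
  simp only [zero_add] at h7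
  omega

/-- The number of ways to distribute `q` zeros over a stripped Catalan word with `m` zeros. -/
def zeroPlacements (m : ℕ) : ℕ → ℕ
  | 0 => 0
  | z + 1 => Nat.multichoose (m + 1) z - 1

theorem ncard_zeroOneClass_succ (k q i : ℕ) :
    (zeroOneClass k q (i + 1)).ncard =
      (zeroClass k (i + 1)).ncard * zeroPlacements (i + 1) q := by
  rcases q with _ | z
  · rw [zeroPlacements, mul_zero, Set.ncard_eq_zero (finite_zeroOneClass _ _ _)]
    ext w
    simp only [zeroOneClass, Set.mem_ofPred_eq, Set.mem_empty_iff_false, iff_false]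
    rintro ⟨h1, -, h3, h4⟩
    simp [h1.eq_nil_of_count_zero h3] at h4
  · rcases k with _ | k
    · rw [zeroClass_of_lt i.succ_pos, Set.ncard_empty, zero_mul,
        Set.ncard_eq_zero (finite_zeroOneClass _ _ _)]
      ext w
      simp only [zeroOneClass, Set.mem_ofPred_eq, Set.mem_empty_iff_false, iff_false]
      rintro ⟨-, h2, -, h4⟩
      have h5 := count_strip w 0
      rw [List.eq_nil_of_length_eq_zero h2, zero_add, h4] at h5
      simp at h5
    · exact ncard_zeroOneClass k.succ_ne_zero z (i + 1)

theorem ncard_oneClass_succ (n i : ℕ) :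
    (oneClass n (i + 1)).ncard = ∑ p ∈ antidiagonal n,
      (zeroClass p.1 (i + 1)).ncard * zeroPlacements (i + 1) p.2 := by
  have hfin : (oneClass n (i + 1)).Finite :=
    (finite_isCatalanList n).subset fun _ hw => ⟨hw.1, hw.2.1⟩
  rw [Set.ncard_eq_sum_ncard_fiber hfin (f := fun w => ((strip w).length, w.count 0))
    (t := antidiagonal n)]
  · refine Finset.sum_congr rfl fun p hp => ?_
    rw [Finset.HasAntidiagonal.mem_antidiagonal] at hp
    rw [← ncard_zeroOneClass_succ]
    congr 1
    ext w
    have := length_strip_add_count w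
    simp only [oneClass, zeroOneClass, Set.mem_ofPred_eq, Prod.ext_iff]
    constructor
    · rintro ⟨⟨h1, h2, h3⟩, h4, h5⟩
      exact ⟨h1, h4, h5, h3⟩
    · rintro ⟨h1, h4, h5, h3⟩
      exact ⟨⟨h1, by omega, h3⟩, h4, h5⟩
  · intro w hw
    rw [Finset.HasAntidiagonal.mem_antidiagonal, length_strip_add_count, hw.2.1]

section

variable {x : ℝ}

theorem sum_range_catalan_mul_pow_le (hx0 : 0 < x) (hx : x < 1 / 4) (N : ℕ) :
    ∑ n ∈ Finset.range N, (catalan n : ℝ) * x ^ n ≤ 2 := by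
  calc ∑ n ∈ Finset.range N, (catalan n : ℝ) * x ^ n
      ≤ ∑ n ∈ Finset.range N, (catalan n : ℝ) / 4 ^ n := by
        refine Finset.sum_le_sum fun n _ => ?_
        rw [div_eq_mul_one_div, ← one_div_pow]
        gcongr
    _ ≤ 2 := by
        rw [sum_range_catalan_div_four_pow]
        have : (0 : ℝ) ≤ 2 * (Nat.centralBinom N : ℝ) / 4 ^ N := by positivity
        linarith

theorem summable_catalan_mul_pow (hx0 : 0 < x) (hx : x < 1 / 4) :
    Summable fun n => (catalan n : ℝ) * x ^ n :=
  summable_of_sum_range_le (fun _ => by positivity) (sum_range_catalan_mul_pow_le hx0 hx)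

/-- Cauchy product of two nonnegative series weighted by powers of `x`. -/
theorem HasSum.cauchy_mul_pow {f g : ℕ → ℝ} {a b : ℝ} (hx0 : 0 < x)
    (hf0 : ∀ n, 0 ≤ f n) (hg0 : ∀ n, 0 ≤ g n)
    (hf : HasSum (fun n => f n * x ^ n) a) (hg : HasSum (fun n => g n * x ^ n) b) :
    HasSum (fun n => (∑ p ∈ antidiagonal n, f p.1 * g p.2) * x ^ n) (a * b) := by
  have hf' : Summable fun n => ‖f n * x ^ n‖ := by
    simpa only [Real.norm_of_nonneg (mul_nonneg (hf0 _) (pow_pos hx0 _).le)] using hf.summable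
  have hg' : Summable fun n => ‖g n * x ^ n‖ := by
    simpa only [Real.norm_of_nonneg (mul_nonneg (hg0 _) (pow_pos hx0 _).le)] using hg.summable
  have h1 := (summable_norm_sum_mul_antidiagonal_of_summable_norm hf' hg').of_norm.hasSum
  rw [← tsum_mul_tsum_eq_tsum_sum_antidiagonal_of_summable_norm hf' hg', hf.tsum_eq,
    hg.tsum_eq] at h1
  refine h1.congr_fun fun n => ?_
  rw [Finset.sum_mul]
  refine Finset.sum_congr rfl fun p hp => ?_
  rw [← Finset.HasAntidiagonal.mem_antidiagonal.1 hp, pow_add]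
  ring

theorem Cfun_spec (hx0 : 0 < x) (hx : x < 1 / 4) :
    x * Cfun x ^ 2 + 1 = Cfun x ∧ x * Cfun x < 1 / 2 ∧ 0 < Cfun x := by
  have hs : 0 < Real.sqrt (1 - 4 * x) := Real.sqrt_pos.2 (by linarith)
  have hs1 : Real.sqrt (1 - 4 * x) < 1 := by
    rw [Real.sqrt_lt' one_pos]
    linarith
  have hsq : Real.sqrt (1 - 4 * x) ^ 2 = 1 - 4 * x := Real.sq_sqrt (by linarith)
  have hC : x * Cfun x = (1 - Real.sqrt (1 - 4 * x)) / 2 := by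
    rw [Cfun]
    field_simp
  refine ⟨?_, by rw [hC]; linarith, div_pos (by linarith) (by linarith)⟩
  apply mul_left_cancel₀ hx0.ne'
  calc x * (x * Cfun x ^ 2 + 1) = (x * Cfun x) ^ 2 + x := by ring
    _ = x * Cfun x := by rw [hC]; linear_combination hsq / 4

theorem hasSum_catalan_mul_pow (hx0 : 0 < x) (hx : x < 1 / 4) :
    HasSum (fun n => (catalan n : ℝ) * x ^ n) (Cfun x) := by
  have hF := (summable_catalan_mul_pow hx0 hx).hasSum
  set F := ∑' n, (catalan n : ℝ) * x ^ n with hFdef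
  have hF2 : F ≤ 2 := (summable_catalan_mul_pow hx0 hx).tsum_le_of_sum_range_le
    (sum_range_catalan_mul_pow_le hx0 hx)
  have hsq := HasSum.cauchy_mul_pow hx0 (fun _ => Nat.cast_nonneg _)
    (fun _ => Nat.cast_nonneg _) hF hF
  have heq : F = 1 + F * F * x := by
    refine (summable_catalan_mul_pow hx0 hx).tsum_eq_zero_add.trans ?_
    simp only [catalan_zero, Nat.cast_one, pow_zero, mul_one]
    congr 1
    rw [← (hsq.mul_right x).tsum_eq]
    refine tsum_congr fun n => ?_
    rw [catalan_succ', pow_succ]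
    push_cast
    ring
  obtain ⟨h1, h2, -⟩ := Cfun_spec hx0 hx
  have h3 : (F - Cfun x) * (1 - x * F - x * Cfun x) = 0 := by linear_combination heq + h1
  rcases mul_eq_zero.1 h3 with h | h
  · rwa [sub_eq_zero.1 h] at hF
  · nlinarith

theorem hasSum_ballot_mul_pow (hx0 : 0 < x) (hx : x < 1 / 4) (z : ℕ) :
    HasSum (fun n => (ballot n z : ℝ) * x ^ n) (Cfun x ^ z) := by
  induction z with
  | zero =>
    rw [pow_zero]
    convert hasSum_ite_eq (0 : ℕ) (1 : ℝ) using 2 with n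
    by_cases h : n = 0 <;> simp [ballot_zero_right, h]
  | succ z ih =>
    rw [pow_succ]
    refine (HasSum.cauchy_mul_pow hx0 (fun _ => Nat.cast_nonneg _) (fun _ => Nat.cast_nonneg _) ih
      (hasSum_catalan_mul_pow hx0 hx)).congr_fun fun n => ?_
    rw [ballot, pow_succ, PowerSeries.coeff_mul]
    simp [ballot]

theorem hasSum_multichoose_mul_pow (hx0 : 0 < x) (hx : x < 1 / 4) (i : ℕ) :
    HasSum (fun z => (Nat.multichoose (i + 1) z : ℝ) * x ^ z) (1 / (1 - x) ^ (i + 1)) := by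
  have h := hasSum_choose_mul_geometric_of_norm_lt_one i (r := x)
    (by rw [Real.norm_of_nonneg hx0.le]; linarith)
  refine h.congr_fun fun z => ?_
  rw [Nat.multichoose_eq, show i + 1 + z - 1 = z + i by omega, Nat.choose_symm_add]

end

theorem countEq_eq_count {n : ℕ} (a : Fin n → ℕ) (c : ℕ) :
    countEq a c = (List.ofFn a).count c := by
  rw [countEq, List.ofFn_eq_map, List.count, List.countP_map, List.countP_eq_length_filter,
    ← List.toFinset_card_of_nodup ((List.nodup_finRange n).filter _), ← Set.ncard_coe_finset]
  congr 1
  ext i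
  simp

theorem isCatalanWord_iff {n : ℕ} (a : Fin n → ℕ) :
    IsCatalanWord a ↔ IsCatalanList_s14 (List.ofFn a) := by
  have hchain : (∀ (i : ℕ) (h : i + 1 < n),
      a ⟨i, Nat.lt_of_succ_lt h⟩ ≤ a ⟨i + 1, h⟩ + 1) ↔ SmallDescents (List.ofFn a) := by
    rw [SmallDescents, List.isChain_ofFn]
  rw [IsCatalanWord, hchain]
  constructor
  · rintro ⟨h1, h2⟩
    refine ⟨h1, fun p k s h hp => ?_⟩
    have hlen : p.length < n := by
      have := congrArg List.length h
      simp at this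
      omega
    have hget (j : Fin n) : a j = (p ++ (k + 1) :: s)[j.1]'(by simp [← h]) := by
      simp [← h]
    have hi : a ⟨p.length, hlen⟩ = k + 1 := by simp [hget]
    obtain ⟨⟨i₁, hi₁, h3⟩, i₂, hi₂, h4⟩ := h2 ⟨p.length, hlen⟩ (by omega) fun j hj => by
      by_contra hlt
      rw [not_le, Fin.lt_def] at hlt
      rw [hi, hget, List.getElem_append_left hlt] at hj
      exact hp (hj ▸ List.getElem_mem hlt)
    rw [hi] at h3 h4
    rw [Fin.lt_def] at hi₁ hi₂
    constructor
    · rw [hget, List.getElem_append_left hi₁] at h3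
      rw [← Nat.succ_injective h3]
      exact List.getElem_mem _
    · rw [hget, List.getElem_append_right hi₂.le, List.getElem_cons] at h4
      simp only at hi₂
      rw [dif_neg (by omega)] at h4
      rw [← Nat.succ_injective h4]
      exact List.getElem_mem _
  · rintro ⟨h1, h2⟩
    refine ⟨h1, fun i hi hmin => ?_⟩
    obtain ⟨k, hk⟩ : ∃ k, a i = k + 1 := ⟨a i - 1, by omega⟩
    have hsplit : List.ofFn a =
        (List.ofFn a).take i ++ (k + 1) :: (List.ofFn a).drop (i + 1) := by
      have hi' : (i : ℕ) < (List.ofFn a).length := by simp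
      conv_lhs => rw [← List.take_append_drop i (List.ofFn a), List.drop_eq_getElem_cons hi']
      simp [hk]
    obtain ⟨h3, h4⟩ := h2 _ _ _ hsplit fun hmem => by
      obtain ⟨j, hj, hj'⟩ := List.mem_take_iff_getElem.1 hmem
      have hj2 : j < n ∧ j < i := by
        simp only [List.length_ofFn] at hj
        omega
      have := hmin ⟨j, hj2.1⟩ (by rw [hk, ← hj']; simp)
      rw [Fin.le_def] at this
      simp only at this
      omega
    constructor
    · obtain ⟨j, hj, hj'⟩ := List.mem_take_iff_getElem.1 h3
      have hj2 : j < n ∧ j < i := by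
        simp only [List.length_ofFn] at hj
        omega
      exact ⟨⟨j, hj2.1⟩, hj2.2, by rw [hk, ← hj']; simp⟩
    · obtain ⟨j, hj, hj'⟩ := List.mem_drop_iff_getElem.1 h4
      simp only [List.length_ofFn] at hj
      refine ⟨⟨i + 1 + j, by omega⟩, ?_, by rw [hk, ← hj']; simp⟩
      rw [Fin.lt_def]
      simp only
      omega

theorem bO_eq_ncard_oneClass (n m : ℕ) : bO n m = (oneClass n m).ncard := by
  rw [bO, ← Set.ncard_image_of_injective _ (List.ofFn_injective (n := n))]
  congr 1
  ext w
  simp only [Set.mem_image, Set.mem_ofPred_eq, oneClass, isCatalanWord_iff, countEq_eq_count]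
  constructor
  · rintro ⟨a, ⟨h1, h2⟩, rfl⟩
    exact ⟨h1, List.length_ofFn, h2⟩
  · rintro ⟨h1, rfl, h3⟩
    exact ⟨w.get, by simpa using ⟨h1, h3⟩, by simp⟩

section

variable {x v : ℝ}

theorem hasSum_ncard_zeroClass (hx0 : 0 < x) (hx : x < 1 / 4) (i : ℕ) :
    HasSum (fun n => ((zeroClass n (i + 1)).ncard : ℝ) * x ^ n) (x ^ (i + 1) * Cfun x ^ i) := by
  have h : HasSum (fun n => ((zeroClass (n + (i + 1)) (i + 1)).ncard : ℝ) * x ^ (n + (i + 1)))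
      (x ^ (i + 1) * Cfun x ^ i) := by
    refine ((hasSum_ballot_mul_pow hx0 hx i).mul_left (x ^ (i + 1))).congr_fun fun n => ?_
    rw [ncard_zeroClass, pow_add]
    ring
  have h0 : ∑ n ∈ Finset.range (i + 1), ((zeroClass n (i + 1)).ncard : ℝ) * x ^ n = 0 :=
    Finset.sum_eq_zero fun n hn => by
      rw [zeroClass_of_lt (Finset.mem_range.1 hn)]
      simp
  have := (hasSum_nat_add_iff (f := fun n => ((zeroClass n (i + 1)).ncard : ℝ) * x ^ n)
    (i + 1)).1 h
  rwa [h0, add_zero] at this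

theorem hasSum_zeroPlacements (hx0 : 0 < x) (hx : x < 1 / 4) (i : ℕ) :
    HasSum (fun q => (zeroPlacements (i + 1) q : ℝ) * x ^ q)
      (x * (1 / (1 - x) ^ (i + 2) - 1 / (1 - x))) := by
  have h : HasSum (fun q => (zeroPlacements (i + 1) (q + 1) : ℝ) * x ^ (q + 1))
      (x * (1 / (1 - x) ^ (i + 2) - 1 / (1 - x))) := by
    have hg := hasSum_geometric_of_lt_one hx0.le (by linarith : x < 1)
    rw [← one_div] at hg
    refine (((hasSum_multichoose_mul_pow hx0 hx (i + 1)).sub hg).mul_left x).congr_fun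
      fun q => ?_
    rw [zeroPlacements, Nat.cast_sub (one_le_multichoose_succ _ _), pow_succ]
    push_cast
    ring
  have := (hasSum_nat_add_iff (f := fun q => (zeroPlacements (i + 1) q : ℝ) * x ^ q) 1).1 h
  simpa [zeroPlacements] using this

theorem hasSum_bO_succ (hx0 : 0 < x) (hx : x < 1 / 4) (i : ℕ) :
    HasSum (fun n => (bO n (i + 1) : ℝ) * x ^ n * v ^ (i + 1))
      (x ^ (i + 1) * Cfun x ^ i * (x * (1 / (1 - x) ^ (i + 2) - 1 / (1 - x))) *
        v ^ (i + 1)) := by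
  refine (HasSum.mul_right _ <| HasSum.cauchy_mul_pow hx0 (fun _ => Nat.cast_nonneg _)
    (fun _ => Nat.cast_nonneg _) (hasSum_ncard_zeroClass hx0 hx i)
    (hasSum_zeroPlacements hx0 hx i)).congr_fun fun n => ?_
  rw [bO_eq_ncard_oneClass, ncard_oneClass_succ]
  push_cast
  rfl

theorem hasSum_geometric_difference {r s t : ℝ} (ht : 0 < t) (hr0 : 0 ≤ r) (hr1 : r < t)
    (hr2 : r < 1) :
    HasSum (fun i : ℕ => s * r ^ i * (1 / t ^ (i + 2) - 1 / t))
      (s * (1 / (t * (t - r)) - 1 / (t * (1 - r)))) := by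
  have h1 := (hasSum_geometric_of_lt_one (div_nonneg hr0 ht.le)
    ((div_lt_one ht).2 hr1)).mul_left (s / t ^ 2)
  have h2 := (hasSum_geometric_of_lt_one hr0 hr2).mul_left (s / t)
  have h3 : t - r ≠ 0 := by linarith
  have h4 : 1 - r ≠ 0 := by linarith
  have h5 : 1 - r / t ≠ 0 := by
    rw [one_sub_div ht.ne']
    exact div_ne_zero h3 ht.ne'
  have h6 : s / t ^ 2 * (1 - r / t)⁻¹ - s / t * (1 - r)⁻¹ =
      s * (1 / (t * (t - r)) - 1 / (t * (1 - r))) := by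
    rw [one_sub_div ht.ne']
    field_simp
  rw [← h6]
  refine (h1.sub h2).congr_fun fun i => ?_
  rw [div_pow, pow_add]
  field_simp

theorem Bterm_eq (x v : ℝ) (n : ℕ) :
    Bterm x v n = (if n = 0 then 0 else x ^ n) +
      ∑ i ∈ Finset.range (n - 1), (bO n (i + 1) : ℝ) * x ^ n * v ^ (i + 1) := by
  rcases n with _ | n
  · simp [Bterm]
  · rw [Bterm, Finset.sum_range_succ', bO_eq_ncard_oneClass _ 0, ncard_oneClass_zero]
    simp [add_comm]

theorem hasSum_Bterm (hx0 : 0 < x) (hx : x < 1 / 4) (hv0 : 0 ≤ v) (hv1 : v ≤ 1) :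
    HasSum (Bterm x v) (x / (1 - x) + x ^ 2 * v *
      (1 / ((1 - x) * (1 - x - x * v * Cfun x)) - 1 / ((1 - x) * (1 - x * v * Cfun x)))) := by
  obtain ⟨-, hC, hC0⟩ := Cfun_spec hx0 hx
  have hr0 : 0 ≤ x * v * Cfun x := by positivity
  have hr1 : x * v * Cfun x < 1 / 2 := by
    nlinarith [mul_nonneg (mul_nonneg hx0.le hC0.le) (sub_nonneg.2 hv1)]
  have hrow : HasSum (fun i => x ^ (i + 1) * Cfun x ^ i *
      (x * (1 / (1 - x) ^ (i + 2) - 1 / (1 - x))) * v ^ (i + 1)) (x ^ 2 * v *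
      (1 / ((1 - x) * (1 - x - x * v * Cfun x)) - 1 / ((1 - x) * (1 - x * v * Cfun x)))) := by
    refine (hasSum_geometric_difference (s := x ^ 2 * v) (by linarith) hr0
      (by linarith : _ < 1 - x) (by linarith)).congr_fun fun i => ?_
    ring
  have hsum : Summable fun p : ℕ × ℕ => (bO p.2 (p.1 + 1) : ℝ) * x ^ p.2 * v ^ (p.1 + 1) := by
    rw [summable_prod_of_nonneg fun p => by positivity]
    refine ⟨fun i => (hasSum_bO_succ hx0 hx i).summable, ?_⟩
    simpa only [(hasSum_bO_succ hx0 hx _).tsum_eq] using hrow.summable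
  have htot := hsum.hasSum
  rw [(htot.prod_fiberwise fun i => hasSum_bO_succ hx0 hx i).unique hrow,
    ← (Equiv.prodComm ℕ ℕ).hasSum_iff] at htot
  have hcol := htot.prod_fiberwise (g := fun n => ∑ i ∈ Finset.range (n - 1),
    (bO n (i + 1) : ℝ) * x ^ n * v ^ (i + 1)) fun n => by
      refine hasSum_sum_of_ne_finset_zero fun i hi => ?_
      rw [Finset.mem_range, not_lt] at hi
      simp [bO_eq_ncard_oneClass, oneClass_of_le i.succ_ne_zero (by omega : n ≤ i + 1)]
  have hzero : HasSum (fun n : ℕ => if n = 0 then 0 else x ^ n) (x / (1 - x)) := by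
    have h := (hasSum_geometric_of_lt_one hx0.le (by linarith : x < 1)).mul_left x
    have := (hasSum_nat_add_iff (f := fun n : ℕ => if n = 0 then 0 else x ^ n) 1).1
      (h.congr_fun fun n => by simp [pow_succ'])
    simpa [div_eq_mul_inv] using this
  exact (hzero.add hcol).congr_fun fun n => Bterm_eq x v n

end

/-- Closed form for `B(x,v)` for `0 < x < 1/4` and `0 ≤ v ≤ 1`. -/
theorem B_closed_form (x v : ℝ) (hx0 : 0 < x) (hx : x < 1/4) (hv0 : 0 ≤ v) (hv1 : v ≤ 1) :
    Summable (Bterm x v) ∧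
    ∑' n : ℕ, Bterm x v n =
      x * (1 - x + x ^ 2 * v + x * v * (x - 2) * Cfun x + x ^ 2 * v ^ 2 * (Cfun x) ^ 2) /
        ((1 - x) * (1 - x * v * Cfun x) * (1 - x - x * v * Cfun x)) := by
  have h := hasSum_Bterm hx0 hx hv0 hv1
  refine ⟨h.summable, h.tsum_eq.trans ?_⟩
  obtain ⟨-, hC, hC0⟩ := Cfun_spec hx0 hx
  have hr1 : x * v * Cfun x < 1 / 2 := by
    nlinarith [mul_nonneg (mul_nonneg hx0.le hC0.le) (sub_nonneg.2 hv1)]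
  have h1 : 1 - x ≠ 0 := by linarith
  have h2 : 1 - x * v * Cfun x ≠ 0 := by linarith
  have h3 : 1 - x - x * v * Cfun x ≠ 0 := by linarith
  field_simp
  ring
end
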